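/- With notation as in the jumping-polynomial construction, let J, J′ ⊆ ℕ. Assume: for every i ∈ J, β_i ∈ S_{i−1} and there exist M_i ≥ 1, nonzero scalars χ_1, …, χ_{M_i} ∈ 𝐤 and distinct pairs (X_1,Y_1), …, (X_{M_i},Y_{M_i}) of tuples of nonnegative integers, each irreducible with respect to 𝒯, such that P_i = Σ_{e=1}^{M_i} χ_e P^{X_e}T^{Y_e}; and for every j ∈ J′, γ_j ∈ S_{m_j} + U_{j−1} and there exist N_j ≥ 0, nonzero scalars ψ_1, …, ψ_{N_j} ∈ 𝐤 and distinct pairs (Z_1,W_1), …, (Z_{N_j},W_{N_j}), each irreducible with respect to 𝒯, such that T_j = Σ_{e=1}^{N_j} ψ_e P^{Z_e}T^{W_e} (the empty sum meaning T_j = 0). Then {P_i : i ∉ J} ∪ {T_j : j ∉ J′} is a generating sequence of ν in R. -/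

import Mathlib

/-! Core combinatorial definitions for the jumping-polynomial construction. -/

namespace Jump

/-- Tuples of nonnegative integers, indexed by positive integers (index 0 unused). -/
abbrev Vec := ℕ → ℕ

/-- Pairs of tuples. -/
abbrev PVec := Vec × Vec

/-- `A` is a tuple in `ℕ₀^k` (entries indexed by `1, …, k`). -/
def Supp (k : ℕ) (A : Vec) : Prop := ∀ j : ℕ, (j = 0 ∨ k < j) → A j = 0

/-- `A` is a tuple in `ℤ^k` (entries indexed by `1, …, k`). -/
def SuppZ (k : ℕ) (A : ℕ → ℤ) : Prop := ∀ j : ℕ, (j = 0 ∨ k < j) → A j = 0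

/-- `(A, C)` is irreducible with respect to a set `T` of pairs of tuples: no member of `T`
is componentwise less than or equal to `(A, C)`. -/
def Irr (T : Set PVec) (p : PVec) : Prop := ∀ bd ∈ T, ¬ (bd.1 ≤ p.1 ∧ bd.2 ≤ p.2)

/-- The weight `A·β(k) = a₁β₁ + ⋯ + a_kβ_k` of a tuple of nonnegative integers. -/
noncomputable def wtA (β : ℕ → ℝ) (k : ℕ) (A : Vec) : ℝ :=
  ∑ j ∈ Finset.Icc 1 k, (A j : ℝ) * β j

/-- The weight of a tuple of integers. -/
noncomputable def wtZ (β : ℕ → ℝ) (k : ℕ) (A : ℕ → ℤ) : ℝ :=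
  ∑ j ∈ Finset.Icc 1 k, (A j : ℝ) * β j

/-- The weight `|(A, C)| = A·β(k) + C·γ(i)` of a pair of tuples. -/
noncomputable def wt (β γ : ℕ → ℝ) (k i : ℕ) (p : PVec) : ℝ :=
  wtA β k p.1 + wtA γ i p.2

/-- The group `G_n = β₁ℤ + ⋯ + β_nℤ` (as a subset of `ℝ`; `G_0 = {0}`). -/
noncomputable def Gr (β : ℕ → ℝ) (n : ℕ) : Set ℝ :=
  {t | ∃ A : ℕ → ℤ, SuppZ n A ∧ t = wtZ β n A}

/-- The semigroup `S_n = β₁ℕ₀ + ⋯ + β_nℕ₀` (as a subset of `ℝ`; `S_0 = {0}`). -/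
noncomputable def Sg (β : ℕ → ℝ) (n : ℕ) : Set ℝ :=
  {t | ∃ A : Vec, Supp n A ∧ t = wtA β n A}

/-- The set `G_k + H_i`. -/
noncomputable def GrH (β γ : ℕ → ℝ) (k i : ℕ) : Set ℝ :=
  {t | ∃ a ∈ Gr β k, ∃ b ∈ Gr γ i, t = a + b}

/-- The set `G + H_i`, where `G = ⋃_{n ≤ len} G_n`. -/
noncomputable def GH (β γ : ℕ → ℝ) (len : ℕ∞) (i : ℕ) : Set ℝ :=
  {t | ∃ k : ℕ, (k : ℕ∞) ≤ len ∧ t ∈ GrH β γ k i}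

/-- The set `S_k + U_i`. -/
noncomputable def SU (β γ : ℕ → ℝ) (k i : ℕ) : Set ℝ :=
  {t | ∃ a ∈ Sg β k, ∃ b ∈ Sg γ i, t = a + b}

/-- The `j`-th standard basis vector `E_j`. -/
def unitVec (j : ℕ) : Vec := fun l => if l = j then 1 else 0

/-- The set `𝒫 = {(q_jE_j, 0̄) : j ≥ 2, q_j < ∞}`. -/
def Pset (q : ℕ → ℕ∞) : Set PVec :=
  {p | ∃ j : ℕ, 2 ≤ j ∧ ∃ t : ℕ, q j = (t : ℕ∞) ∧
        p = (fun l => t * unitVec j l, fun _ => 0)}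

/-- `(A, C) ∈ ℕ₀^{m_i} × ℕ₀^i` pushes `γ_i`: `c_i > 0` and `|(A, C)| ∈ S_{m_i} + U_{i-1}`. -/
noncomputable def Push (β γ : ℕ → ℝ) (mi i : ℕ) (p : PVec) : Prop :=
  0 < p.2 i ∧ wt β γ mi i p ∈ SU β γ mi (i - 1)

/-- `(A, C)` is reduced: it pushes `γ_i` and no pair strictly below it (componentwise) does. -/
noncomputable def Red (β γ : ℕ → ℝ) (mi i : ℕ) (p : PVec) : Prop :=
  Push β γ mi i p ∧
    ∀ p' : PVec, p'.1 ≤ p.1 → p'.2 ≤ p.2 → p' ≠ p → ¬ Push β γ mi i p'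

/-- The set `𝒟_i`, built from `𝒯_i`: empty if `s_i = ∞`, otherwise the pairs in
`ℕ₀^{m_i} × ℕ₀^i` that are irreducible with respect to `𝒯_i` and reduced. -/
noncomputable def Dstep (β γ : ℕ → ℝ) (s : ℕ → ℕ∞) (m : ℕ → ℕ) (i : ℕ)
    (Ti : Set PVec) : Set PVec :=
  if s i = ⊤ then ∅ else
    {p | Supp (m i) p.1 ∧ Supp i p.2 ∧ Irr Ti p ∧ Red β γ (m i) i p}

/-- The chain `𝒯_1 = 𝒫`, `𝒯_{i+1} = 𝒯_i ∪ 𝒟_i` (here `Tchain 0 = Tchain 1 = 𝒫`,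
which is forced by the convention `s 0 = ⊤`). -/
noncomputable def Tchain (β γ : ℕ → ℝ) (q s : ℕ → ℕ∞) (m : ℕ → ℕ) : ℕ → Set PVec
  | 0 => Pset q
  | n + 1 => Tchain β γ q s m n ∪ Dstep β γ s m n (Tchain β γ q s m n)

/-- The set `𝒯 = ⋃_i 𝒯_i`. -/
noncomputable def Tfull (β γ : ℕ → ℝ) (q s : ℕ → ℕ∞) (m : ℕ → ℕ) : Set PVec :=
  ⋃ n, Tchain β γ q s m n

/-- A tuple `A ∈ ℤ^k` is permissible: `0 ≤ a_j < q_j` for all `1 ≤ j ≤ k` with `q_j < ∞`. -/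
def PermZ (q : ℕ → ℕ∞) (k : ℕ) (A : ℕ → ℤ) : Prop :=
  ∀ j : ℕ, 1 ≤ j → j ≤ k → ∀ t : ℕ, q j = (t : ℕ∞) → 0 ≤ A j ∧ A j < (t : ℤ)

/-- A tuple `A ∈ ℕ₀^k` is permissible: `a_j < q_j` for all `1 ≤ j ≤ k` with `q_j < ∞`. -/
def PermN (q : ℕ → ℕ∞) (k : ℕ) (A : Vec) : Prop :=
  ∀ j : ℕ, 1 ≤ j → j ≤ k → ∀ t : ℕ, q j = (t : ℕ∞) → A j < t

/-- The abstract combinatorial setup of the jumping-polynomial construction: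
a finite (of length `len`) or infinite (`len = ⊤`) sequence `β` of positive reals,
a sequence `γ` of nonnegative reals, and the derived data `q_j`, `s_i`, `m_i`
defined by their minimality properties. -/
structure Setup where
  /-- the length of the `β`-sequence (possibly `∞`) -/
  len : ℕ∞
  β : ℕ → ℝ
  γ : ℕ → ℝ
  q : ℕ → ℕ∞
  s : ℕ → ℕ∞
  m : ℕ → ℕ
  hlen : 2 ≤ len
  hβ : ∀ j : ℕ, 1 ≤ j → (j : ℕ∞) ≤ len → 0 < β j
  hγ : ∀ i : ℕ, 1 ≤ i → 0 ≤ γ i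
  hq1 : q 1 = ⊤
  hqtop : ∀ j : ℕ, len < (j : ℕ∞) → q j = ⊤
  hq : ∀ j : ℕ, 2 ≤ j → (j : ℕ∞) ≤ len →
    q j = sInf {x : ℕ∞ | ∃ t : ℕ, x = (t : ℕ∞) ∧ 0 < t ∧ (t : ℝ) * β j ∈ Gr β (j - 1)}
  /-- if `q_j = ∞` then `β_j` is the last term of the `β`-sequence, and conversely -/
  hlast : ∀ j : ℕ, 2 ≤ j → (j : ℕ∞) ≤ len → (q j = ⊤ ↔ len = (j : ℕ∞))
  /-- `β_{j+1} > q_jβ_j` whenever `q_j < ∞` -/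
  hgrow : ∀ j : ℕ, 2 ≤ j → (j : ℕ∞) ≤ len → ∀ t : ℕ, q j = (t : ℕ∞) →
    (t : ℝ) * β j < β (j + 1)
  hs0 : s 0 = ⊤
  hs : ∀ i : ℕ, 1 ≤ i →
    s i = sInf {x : ℕ∞ | ∃ t : ℕ, x = (t : ℕ∞) ∧ 0 < t ∧ (t : ℝ) * γ i ∈ GH β γ len (i - 1)}
  hm0 : m 0 = 1
  hmtop : ∀ i : ℕ, 1 ≤ i → s i = ⊤ → m i = m (i - 1)
  hmfin : ∀ i : ℕ, 1 ≤ i → ∀ t : ℕ, s i = (t : ℕ∞) →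
    m i = max (m (i - 1))
      (sInf {j : ℕ | 1 ≤ j ∧ (j : ℕ∞) ≤ len ∧ (t : ℝ) * γ i ∈ GrH β γ j (i - 1)})
  hmlen : ∀ i : ℕ, 1 ≤ m i ∧ ((m i : ℕ) : ℕ∞) ≤ len

end Jump

namespace Jump

open Classical in
/-- The added set at step `i` of the `𝒯`-chain in the full construction: `{(0̄, E_i)}` if
`T_i = 0`, and `𝒟_i` otherwise. -/
noncomputable def Astep (β γ : ℕ → ℝ) (s : ℕ → ℕ∞) (m : ℕ → ℕ) (Tz : ℕ → Prop)
    (i : ℕ) (Ti : Set PVec) : Set PVec :=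
  if i = 0 then ∅
  else if Tz i then {(fun _ => 0, unitVec i)}
  else Dstep β γ s m i Ti

open Classical in
/-- The set `𝒟_i` in the full construction: empty when `T_i = 0`. -/
noncomputable def DsetR (β γ : ℕ → ℝ) (s : ℕ → ℕ∞) (m : ℕ → ℕ) (Tz : ℕ → Prop)
    (i : ℕ) (Ti : Set PVec) : Set PVec :=
  if Tz i then ∅ else Dstep β γ s m i Ti

/-- The chain `𝒯_1 = 𝒫`, `𝒯_{i+1} = 𝒯_i ∪ 𝒟_i` (resp. `𝒯_{i+1} = 𝒯_i ∪ {(0̄, E_i)}` when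
`T_i = 0`) of the full construction. -/
noncomputable def TchainR (β γ : ℕ → ℝ) (q s : ℕ → ℕ∞) (m : ℕ → ℕ) (Tz : ℕ → Prop) :
    ℕ → Set PVec
  | 0 => Pset q
  | n + 1 => TchainR β γ q s m Tz n ∪ Astep β γ s m Tz n (TchainR β γ q s m Tz n)

/-- The set `𝒯 = ⋃_i 𝒯_i` of the full construction. -/
noncomputable def TfullR (β γ : ℕ → ℝ) (q s : ℕ → ℕ∞) (m : ℕ → ℕ) (Tz : ℕ → Prop) :
    Set PVec :=
  ⋃ n, TchainR β γ q s m Tz n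

/-- The full setting of the paper: `𝐤` a field, `K` an algebraic function field of
transcendence degree 3 over `𝐤`, `ν` a rank 1 `𝐤`-valuation of `K` (with real values,
written additively) with residue field `𝐤`, and `(R, m_R)` a 3-dimensional regular local
subring of `K` with quotient field `K`, dominated by `ν`, with regular parameters
`x, y, z` of increasing value; together with the sequences `{P_j}`, `{T_i}` of jumping
polynomials produced by the algorithm of Section 3, and all their associated data
(`β`, `γ`, `q`, `s`, `m`, `δ`, `𝒫`, `𝒟_i`, `𝒯_i`). -/
structure RSetup (K : Type) [Field K] where
  /-- the coefficient field `𝐤`, as a subfield of `K` -/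
  kk : Subfield K
  /-- the valuation, written additively -/
  ν : K → ℝ
  /-- the regular local ring `R` -/
  R : Subring K
  x : K
  y : K
  z : K
  /-- the length of the sequence `{P_j}` (possibly `∞`) -/
  len : ℕ∞
  P : ℕ → K
  T : ℕ → K
  β : ℕ → ℝ
  γ : ℕ → ℝ
  q : ℕ → ℕ∞
  s : ℕ → ℕ∞
  m : ℕ → ℕ
  δ : ℕ → ℕ
  -- `K` is an algebraic function field of transcendence degree 3 over `𝐤`:
  hfg : ∃ t : Finset K, Subfield.closure ((kk : Set K) ∪ (t : Set K)) = ⊤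
  htrdeg : ∃ sfn : Fin 3 → K,
    Function.Injective (MvPolynomial.eval₂Hom kk.subtype sfn) ∧
    ∀ a : K, ∃ p : Polynomial K, p ≠ 0 ∧
      (∀ n : ℕ, p.coeff n ∈ Subfield.closure ((kk : Set K) ∪ Set.range sfn)) ∧
      Polynomial.eval a p = 0
  -- `ν` is a rank 1 `𝐤`-valuation with residue field `𝐤`:
  hmul : ∀ f g : K, f ≠ 0 → g ≠ 0 → ν (f * g) = ν f + ν g
  hadd : ∀ f g : K, f ≠ 0 → g ≠ 0 → f + g ≠ 0 → min (ν f) (ν g) ≤ ν (f + g)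
  htriv : ∀ c : K, c ∈ kk → c ≠ 0 → ν c = 0
  hres : ∀ f : K, f ≠ 0 → 0 ≤ ν f → ∃ c ∈ kk, f - c = 0 ∨ 0 < ν (f - c)
  -- `R` is a local subring of `K` containing `𝐤`, with quotient field `K`,
  -- dominated by `ν`:
  hkR : (kk : Set K) ⊆ R
  hfrac : ∀ f : K, ∃ a b : K, a ∈ R ∧ b ∈ R ∧ b ≠ 0 ∧ f = a / b
  hdom : ∀ f ∈ R, f ≠ 0 → 0 ≤ ν f
  hloc : ∀ f ∈ R, f ≠ 0 → ν f = 0 → f⁻¹ ∈ R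
  -- `R` is regular of dimension 3 with regular parameters `x, y, z`, and
  -- `0 < ν(x) ≤ ν(y) ≤ ν(z)`:
  hx : x ∈ R
  hy : y ∈ R
  hz : z ∈ R
  hxne : x ≠ 0
  hyne : y ≠ 0
  hzne : z ≠ 0
  hνx : 0 < ν x
  hνxy : ν x ≤ ν y
  hνyz : ν y ≤ ν z
  hdim : ringKrullDim R = ((3 : ℕ) : WithBot ℕ∞)
  hparam : ∀ (f : K) (hf : f ∈ R), f ≠ 0 → 0 < ν f →
    (⟨f, hf⟩ : R) ∈ Ideal.span ({⟨x, hx⟩, ⟨y, hy⟩, ⟨z, hz⟩} : Set R)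
  -- the sequence `{P_j}` of jumping polynomials and its values `β_j = ν(P_j)`:
  hlen : 2 ≤ len
  hPmem : ∀ j : ℕ, 1 ≤ j → (j : ℕ∞) ≤ len → P j ∈ R
  hPne : ∀ j : ℕ, 1 ≤ j → (j : ℕ∞) ≤ len → P j ≠ 0
  hP1 : P 1 = x
  hP2 : P 2 = y
  hβ : ∀ j : ℕ, 1 ≤ j → (j : ℕ∞) ≤ len → β j = ν (P j)
  hq1 : q 1 = ⊤
  hqtop : ∀ j : ℕ, len < (j : ℕ∞) → q j = ⊤
  hq : ∀ j : ℕ, 2 ≤ j → (j : ℕ∞) ≤ len →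
    q j = sInf {u : ℕ∞ | ∃ t : ℕ, u = (t : ℕ∞) ∧ 0 < t ∧ (t : ℝ) * β j ∈ Gr β (j - 1)}
  /-- the sequence `{P_j}` ends at `P_j` exactly when `q_j = ∞` -/
  hlast : ∀ j : ℕ, 2 ≤ j → (j : ℕ∞) ≤ len → (q j = ⊤ ↔ len = (j : ℕ∞))
  /-- the recursion `P_{j+1} = P_j^{q_j} − λ_jP^{L(j)}`, where `(L(j), 0̄)` is irreducible
  with respect to `𝒫_j` with `q_jβ_j = L(j)·β(j−1)` and `λ_j ∈ 𝐤∖{0}` is the residue of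
  `P_j^{q_j}/P^{L(j)}` (so that `ν(P_{j+1}) > q_jβ_j`) -/
  hPrec : ∀ j : ℕ, 2 ≤ j → (j : ℕ∞) ≤ len → ∀ t : ℕ, q j = (t : ℕ∞) →
    ∃ (lam : K) (LL : Vec), lam ∈ kk ∧ lam ≠ 0 ∧ Supp (j - 1) LL ∧
      (∀ l : ℕ, 2 ≤ l → l ≤ j - 1 → ∀ u : ℕ, q l = (u : ℕ∞) → LL l < u) ∧
      (t : ℝ) * β j = wtA β (j - 1) LL ∧
      P (j + 1) = P j ^ t - lam * ∏ l ∈ Finset.Icc 1 (j - 1), P l ^ LL l ∧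
      (t : ℝ) * β j < ν (P (j + 1))
  -- the sequence `{T_i}` of jumping polynomials and its values `γ_i`:
  hTmem : ∀ i : ℕ, 1 ≤ i → T i ∈ R
  hT1 : T 1 = z
  hγ : ∀ i : ℕ, 1 ≤ i → (T i = 0 → γ i = 0) ∧ (T i ≠ 0 → γ i = ν (T i))
  hs0 : s 0 = ⊤
  hsz : ∀ i : ℕ, 1 ≤ i → T i = 0 → s i = 1 ∧ m i = m (i - 1)
  hs : ∀ i : ℕ, 1 ≤ i → T i ≠ 0 →
    s i = sInf {u : ℕ∞ | ∃ t : ℕ, u = (t : ℕ∞) ∧ 0 < t ∧ (t : ℝ) * γ i ∈ GH β γ len (i - 1)}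
  hm0 : m 0 = 1
  hmtop : ∀ i : ℕ, 1 ≤ i → T i ≠ 0 → s i = ⊤ → m i = m (i - 1)
  hmfin : ∀ i : ℕ, 1 ≤ i → T i ≠ 0 → ∀ t : ℕ, s i = (t : ℕ∞) →
    m i = max (m (i - 1))
      (sInf {j : ℕ | 1 ≤ j ∧ (j : ℕ∞) ≤ len ∧ (t : ℝ) * γ i ∈ GrH β γ j (i - 1)})
  hmlen : ∀ i : ℕ, 1 ≤ m i ∧ ((m i : ℕ) : ℕ∞) ≤ len
  -- `δ_i = #𝒟_i` (with `δ_0 = 1`):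
  hδ0 : δ 0 = 1
  hδ : ∀ i : ℕ, 1 ≤ i →
    (DsetR β γ s m (fun n => T n = 0) i
        (TchainR β γ q s m (fun n => T n = 0) i)).Finite ∧
    δ i = (DsetR β γ s m (fun n => T n = 0) i
        (TchainR β γ q s m (fun n => T n = 0) i)).ncard
  /-- the recursion for the `T`-sequence: for each `i` with `T_i ≠ 0` and `s_i < ∞`, the
  elements of `𝒟_i`, enumerated as `(A,C)_1, …, (A,C)_{δ_i}` in increasing order of
  `|(A,C)|`, give `T_{(Σ_{j=0}^{i-1}δ_j)+k} = T_{AC} = P^AT^C − μ_{AC}P^{L(AC)}T^{N(AC)}`,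
  where `(L(AC), N(AC)) ∈ ℕ₀^{m_i} × ℕ₀^{i-1}` is irreducible with respect to `𝒯_i` with
  `|(L(AC), N(AC))| = |(A,C)|` and `μ_{AC} ∈ 𝐤∖{0}` is the residue of
  `P^AT^C/(P^{L(AC)}T^{N(AC)})` (so that `ν(T_{AC}) > |(A,C)|` unless `T_{AC} = 0`) -/
  hTrec : ∀ i : ℕ, 1 ≤ i → T i ≠ 0 → s i ≠ ⊤ →
    ∃ e : ↥(DsetR β γ s m (fun n => T n = 0) i
        (TchainR β γ q s m (fun n => T n = 0) i)) ≃ Fin (δ i),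
      (∀ p p', ((e p : Fin (δ i)) : ℕ) ≤ ((e p' : Fin (δ i)) : ℕ) →
        wt β γ (m i) i p.1 ≤ wt β γ (m i) i p'.1) ∧
      ∀ p, ∃ (LL NN : Vec) (mu : K),
        Supp (m i) LL ∧ Supp (i - 1) NN ∧
        Irr (TchainR β γ q s m (fun n => T n = 0) i) (LL, NN) ∧
        wt β γ (m i) (i - 1) (LL, NN) = wt β γ (m i) i p.1 ∧
        mu ∈ kk ∧ mu ≠ 0 ∧
        T ((∑ j ∈ Finset.range i, δ j) + ((e p : Fin (δ i)) : ℕ) + 1) =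
          (∏ l ∈ Finset.Icc 1 (m i), P l ^ (p : PVec).1 l) *
            (∏ l ∈ Finset.Icc 1 i, T l ^ (p : PVec).2 l) -
          mu * (∏ l ∈ Finset.Icc 1 (m i), P l ^ LL l) *
            (∏ l ∈ Finset.Icc 1 (i - 1), T l ^ NN l) ∧
        (T ((∑ j ∈ Finset.range i, δ j) + ((e p : Fin (δ i)) : ℕ) + 1) = 0 ∨
          wt β γ (m i) i p.1 <
            ν (T ((∑ j ∈ Finset.range i, δ j) + ((e p : Fin (δ i)) : ℕ) + 1)))

namespace RSetup

variable {K : Type} [Field K] (d : RSetup K)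

/-- The monomial `P^A = ∏_{l=1}^{k} P_l^{a_l}`. -/
noncomputable def Pm (k : ℕ) (A : Vec) : K := ∏ l ∈ Finset.Icc 1 k, d.P l ^ A l

/-- The monomial `T^C = ∏_{l=1}^{i} T_l^{c_l}`. -/
noncomputable def Tm (i : ℕ) (C : Vec) : K := ∏ l ∈ Finset.Icc 1 i, d.T l ^ C l

/-- The set `𝒯 = ⋃_i 𝒯_i` of the construction. -/
noncomputable def TF : Set PVec :=
  TfullR d.β d.γ d.q d.s d.m (fun n => d.T n = 0)

/-- The value semigroup `S_R = ν(R∖{0})`. -/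
def SR : Set ℝ := {t : ℝ | ∃ f : K, f ∈ d.R ∧ f ≠ 0 ∧ d.ν f = t}

/-- The valuation ideal `I_σ = {f ∈ R : ν(f) ≥ σ}` (as a subset of `K`). -/
def Iv (σ : ℝ) : Set K := {f : K | f ∈ d.R ∧ (f = 0 ∨ σ ≤ d.ν f)}

/-- The ideal `𝒜_σ` of `R` generated by the monomials `P^AT^C` with `|(A, C)| ≥ σ`
(as a subset of `K`). -/
noncomputable def Av (σ : ℝ) : Set K :=
  {f : K | ∃ (M : ℕ) (g : Fin M → K) (kb ib : Fin M → ℕ) (A C : Fin M → Vec),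
    (∀ e, g e ∈ d.R) ∧ (∀ e, ((kb e : ℕ) : ℕ∞) ≤ d.len) ∧
    (∀ e, Supp (kb e) (A e)) ∧ (∀ e, Supp (ib e) (C e)) ∧
    (∀ e, σ ≤ wt d.β d.γ (kb e) (ib e) (A e, C e)) ∧
    f = ∑ e, g e * (d.Pm (kb e) (A e) * d.Tm (ib e) (C e))}

/-- The ideal `𝒜⁺_σ` of `R` generated by the monomials `P^AT^C` with `|(A, C)| > σ`
(as a subset of `K`). -/
noncomputable def Avplus (σ : ℝ) : Set K :=
  {f : K | ∃ (M : ℕ) (g : Fin M → K) (kb ib : Fin M → ℕ) (A C : Fin M → Vec),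
    (∀ e, g e ∈ d.R) ∧ (∀ e, ((kb e : ℕ) : ℕ∞) ≤ d.len) ∧
    (∀ e, Supp (kb e) (A e)) ∧ (∀ e, Supp (ib e) (C e)) ∧
    (∀ e, σ < wt d.β d.γ (kb e) (ib e) (A e, C e)) ∧
    f = ∑ e, g e * (d.Pm (kb e) (A e) * d.Tm (ib e) (C e))}

end RSetup

end Jump

namespace Jump

namespace RSetup

variable {K : Type} [Field K] (d : RSetup K)

/-- The pair of tuples underlying a finitely supported exponent vector. -/
def toPair (f : ℕ ⊕ ℕ →₀ ℕ) : PVec := (fun l => f (Sum.inl l), fun l => f (Sum.inr l))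

/-- The jumping polynomials `P_l` and `T_l`, as a single family. -/
def gen : ℕ ⊕ ℕ → K := Sum.elim d.P d.T

/-- The values of the jumping polynomials, as a single family. -/
def val : ℕ ⊕ ℕ → ℝ := Sum.elim d.β d.γ

/-- The monomial in the jumping polynomials with a given exponent vector. -/
noncomputable def mon (f : ℕ ⊕ ℕ →₀ ℕ) : K := f.prod fun i n => d.gen i ^ n

/-- The weight of an exponent vector. -/
noncomputable def weight (f : ℕ ⊕ ℕ →₀ ℕ) : ℝ := f.sum fun i n => (n : ℝ) * d.val i

/-- The indices of nonzero jumping polynomials. -/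
def Adm : ℕ ⊕ ℕ → Prop :=
  Sum.elim (fun l => 1 ≤ l ∧ (l : ℕ∞) ≤ d.len) (fun l => 1 ≤ l ∧ d.T l ≠ 0)

/-- The exponent vectors of monomials in nonzero jumping polynomials. -/
def Valid (f : ℕ ⊕ ℕ →₀ ℕ) : Prop := ∀ i, f i ≠ 0 → d.Adm i

lemma exists_toPair {k i : ℕ} {A C : Vec} (hA : Supp k A) (hC : Supp i C) :
    ∃ f, toPair f = (A, C) := by
  classical
  refine ⟨Finsupp.onFinset ((Finset.Icc 1 k).disjSum (Finset.Icc 1 i)) (Sum.elim A C) ?_, ?_⟩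
  · rintro (l | l) hl
    · have := mt (hA l) hl
      simp only [Finset.inl_mem_disjSum, Finset.mem_Icc]
      omega
    · have := mt (hC l) hl
      simp only [Finset.inr_mem_disjSum, Finset.mem_Icc]
      omega
  · simp [toPair]

lemma toPair_injective : Function.Injective toPair := by
  intro f g h
  ext (l | l)
  · exact congrFun (congrArg Prod.fst h) l
  · exact congrFun (congrArg Prod.snd h) l

lemma support_subset {k i : ℕ} {f : ℕ ⊕ ℕ →₀ ℕ} (hA : Supp k (toPair f).1)
    (hC : Supp i (toPair f).2) :
    f.support ⊆ (Finset.Icc 1 k).disjSum (Finset.Icc 1 i) := by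
  rintro (l | l) hl
  · have := mt (hA l) (Finsupp.mem_support_iff.1 hl)
    simp only [Finset.inl_mem_disjSum, Finset.mem_Icc]
    omega
  · have := mt (hC l) (Finsupp.mem_support_iff.1 hl)
    simp only [Finset.inr_mem_disjSum, Finset.mem_Icc]
    omega

lemma mon_eq {k i : ℕ} {f : ℕ ⊕ ℕ →₀ ℕ} {A C : Vec} (hA : Supp k A) (hC : Supp i C)
    (hf : toPair f = (A, C)) : d.mon f = d.Pm k A * d.Tm i C := by
  obtain ⟨rfl, rfl⟩ := Prod.ext_iff.1 hf
  rw [mon, Finsupp.prod_of_support_subset f (support_subset hA hC) _ (by simp),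
    Finset.prod_disjSum]
  rfl

lemma weight_eq {k i : ℕ} {f : ℕ ⊕ ℕ →₀ ℕ} {A C : Vec} (hA : Supp k A) (hC : Supp i C)
    (hf : toPair f = (A, C)) : d.weight f = wt d.β d.γ k i (A, C) := by
  obtain ⟨rfl, rfl⟩ := Prod.ext_iff.1 hf
  rw [weight, Finsupp.sum_of_support_subset f (support_subset hA hC) _ (by simp),
    Finset.sum_disjSum]
  rfl

lemma mon_add (f g : ℕ ⊕ ℕ →₀ ℕ) : d.mon (f + g) = d.mon f * d.mon g :=
  Finsupp.prod_add_index' (by simp) (by intros; rw [pow_add])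

lemma weight_add (f g : ℕ ⊕ ℕ →₀ ℕ) : d.weight (f + g) = d.weight f + d.weight g :=
  Finsupp.sum_add_index' (by simp) (by intros; push_cast; ring)

@[simp] lemma mon_zero : d.mon 0 = 1 := Finsupp.prod_zero_index

@[simp] lemma weight_zero : d.weight 0 = 0 := Finsupp.sum_zero_index

@[simp] lemma mon_single (i : ℕ ⊕ ℕ) (n : ℕ) : d.mon (Finsupp.single i n) = d.gen i ^ n :=
  Finsupp.prod_single_index (by simp)

@[simp] lemma weight_single (i : ℕ ⊕ ℕ) (n : ℕ) :
    d.weight (Finsupp.single i n) = n * d.val i :=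
  Finsupp.sum_single_index (by simp)

variable {d}

lemma Valid.add {f g : ℕ ⊕ ℕ →₀ ℕ} (hf : d.Valid f) (hg : d.Valid g) : d.Valid (f + g) := by
  intro i hi
  by_cases h : f i = 0
  · exact hg i (by simpa [h] using hi)
  · exact hf i h

lemma Valid.mono {f g : ℕ ⊕ ℕ →₀ ℕ} (hf : d.Valid f) (hg : g ≤ f) : d.Valid g :=
  fun i hi => hf i fun h => hi (Nat.le_zero.1 (h ▸ hg i))

lemma valid_zero : d.Valid 0 := fun _ h => absurd rfl h

lemma valid_single {i : ℕ ⊕ ℕ} (hi : d.Adm i) (n : ℕ) : d.Valid (Finsupp.single i n) := by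
  classical
  intro j hj
  rw [Finsupp.single_apply] at hj
  split_ifs at hj with h
  · exact h ▸ hi
  · exact absurd rfl hj

lemma adm_one : d.Adm (Sum.inl 1) :=
  ⟨le_rfl, le_trans (by norm_num) d.hlen⟩

lemma adm_two : d.Adm (Sum.inl 2) := ⟨by norm_num, by simpa using d.hlen⟩

lemma adm_z : d.Adm (Sum.inr 1) := ⟨le_rfl, by rw [d.hT1]; exact d.hzne⟩

lemma gen_ne_zero {i : ℕ ⊕ ℕ} (hi : d.Adm i) : d.gen i ≠ 0 := by
  rcases i with l | l
  · exact d.hPne l hi.1 hi.2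
  · exact hi.2

lemma gen_mem {i : ℕ ⊕ ℕ} (hi : d.Adm i) : d.gen i ∈ d.R := by
  rcases i with l | l
  · exact d.hPmem l hi.1 hi.2
  · exact d.hTmem l hi.1

lemma val_eq {i : ℕ ⊕ ℕ} (hi : d.Adm i) : d.val i = d.ν (d.gen i) := by
  rcases i with l | l
  · exact d.hβ l hi.1 hi.2
  · exact (d.hγ l hi.1).2 hi.2

lemma nu_one : d.ν 1 = 0 := d.htriv 1 d.kk.one_mem one_ne_zero

lemma nu_smul {c a : K} (hc : c ∈ d.kk) (hc0 : c ≠ 0) (ha : a ≠ 0) : d.ν (c * a) = d.ν a := by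
  rw [d.hmul c a hc0 ha, d.htriv c hc hc0, zero_add]

lemma nu_pow {a : K} (ha : a ≠ 0) (n : ℕ) : d.ν (a ^ n) = n * d.ν a := by
  induction n with
  | zero => simp [nu_one]
  | succ n ih =>
    rw [pow_succ, d.hmul _ _ (pow_ne_zero n ha) ha, ih]
    push_cast
    ring

lemma nu_prod {ι : Type} (s : Finset ι) (a : ι → K) (ha : ∀ i ∈ s, a i ≠ 0) :
    d.ν (∏ i ∈ s, a i) = ∑ i ∈ s, d.ν (a i) := by
  classical
  induction s using Finset.induction_on with
  | empty => simp [nu_one]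
  | insert i s hi ih =>
    have h := fun j hj => ha j (Finset.mem_insert_of_mem hj)
    rw [Finset.prod_insert hi, Finset.sum_insert hi,
      d.hmul _ _ (ha i (Finset.mem_insert_self i s)) (Finset.prod_ne_zero_iff.2 h), ih h]

lemma mon_ne_zero {f : ℕ ⊕ ℕ →₀ ℕ} (hf : d.Valid f) : d.mon f ≠ 0 :=
  Finset.prod_ne_zero_iff.2 fun i hi =>
    pow_ne_zero _ (gen_ne_zero (hf i (Finsupp.mem_support_iff.1 hi)))

lemma nu_mon {f : ℕ ⊕ ℕ →₀ ℕ} (hf : d.Valid f) : d.ν (d.mon f) = d.weight f := by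
  have h : ∀ i ∈ f.support, d.Adm i := fun i hi => hf i (Finsupp.mem_support_iff.1 hi)
  rw [mon, Finsupp.prod, nu_prod _ _ fun i hi => pow_ne_zero _ (gen_ne_zero (h i hi))]
  exact Finset.sum_congr rfl fun i hi => by
    simp only [nu_pow (gen_ne_zero (h i hi)), val_eq (h i hi)]

lemma mon_mem {f : ℕ ⊕ ℕ →₀ ℕ} (hf : d.Valid f) : d.mon f ∈ d.R :=
  Subring.prod_mem _ fun i hi => pow_mem (gen_mem (hf i (Finsupp.mem_support_iff.1 hi))) _

variable (d)

/-- The elements of `K` of value at least `τ`, as an `R`-module. -/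
def vge (τ : ℝ) : Submodule d.R K where
  carrier := {f | f ≠ 0 → τ ≤ d.ν f}
  zero_mem' := fun h => absurd rfl h
  add_mem' := by
    intro a b ha hb hab
    by_cases ha0 : a = 0
    · simpa [ha0] using hb (by simpa [ha0] using hab)
    by_cases hb0 : b = 0
    · simpa [hb0] using ha ha0
    exact (le_min (ha ha0) (hb hb0)).trans (d.hadd a b ha0 hb0 hab)
  smul_mem' := by
    intro r a ha hra
    rw [Subring.smul_def, smul_eq_mul] at hra ⊢
    have h := ha (right_ne_zero_of_mul hra)
    have h2 := d.hdom r r.2 (left_ne_zero_of_mul hra)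
    rw [d.hmul _ _ (left_ne_zero_of_mul hra) (right_ne_zero_of_mul hra)]
    linarith

/-- The elements of `K` of value greater than `τ`, as an `R`-module. -/
def vgt (τ : ℝ) : Submodule d.R K where
  carrier := {f | f ≠ 0 → τ < d.ν f}
  zero_mem' := fun h => absurd rfl h
  add_mem' := by
    intro a b ha hb hab
    by_cases ha0 : a = 0
    · simpa [ha0] using hb (by simpa [ha0] using hab)
    by_cases hb0 : b = 0
    · simpa [hb0] using ha ha0
    exact (lt_min (ha ha0) (hb hb0)).trans_le (d.hadd a b ha0 hb0 hab)
  smul_mem' := by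
    intro r a ha hra
    rw [Subring.smul_def, smul_eq_mul] at hra ⊢
    have h := ha (right_ne_zero_of_mul hra)
    have h2 := d.hdom r r.2 (left_ne_zero_of_mul hra)
    rw [d.hmul _ _ (left_ne_zero_of_mul hra) (right_ne_zero_of_mul hra)]
    linarith

/-- The `R`-module generated by the monomials of weight at least `τ`. -/
noncomputable def monGe (τ : ℝ) : Submodule d.R K :=
  Submodule.span d.R (d.mon '' {f | d.Valid f ∧ τ ≤ d.weight f})

/-- The `R`-module generated by the monomials of weight greater than `τ`. -/
noncomputable def monGt (τ : ℝ) : Submodule d.R K :=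
  Submodule.span d.R (d.mon '' {f | d.Valid f ∧ τ < d.weight f})

variable {d}

lemma mem_vge {τ : ℝ} {a : K} : a ∈ d.vge τ ↔ (a ≠ 0 → τ ≤ d.ν a) := Iff.rfl

lemma mem_vgt {τ : ℝ} {a : K} : a ∈ d.vgt τ ↔ (a ≠ 0 → τ < d.ν a) := Iff.rfl

lemma mon_mem_monGe {f : ℕ ⊕ ℕ →₀ ℕ} (hf : d.Valid f) {τ : ℝ} (h : τ ≤ d.weight f) :
    d.mon f ∈ d.monGe τ := Submodule.subset_span ⟨f, ⟨hf, h⟩, rfl⟩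

lemma mon_mem_monGt {f : ℕ ⊕ ℕ →₀ ℕ} (hf : d.Valid f) {τ : ℝ} (h : τ < d.weight f) :
    d.mon f ∈ d.monGt τ := Submodule.subset_span ⟨f, ⟨hf, h⟩, rfl⟩

lemma monGt_le_vgt (τ : ℝ) : d.monGt τ ≤ d.vgt τ := by
  refine Submodule.span_le.2 ?_
  rintro _ ⟨f, ⟨hf, h⟩, rfl⟩ -
  rwa [nu_mon hf]

lemma smul_mem_of_mem (N : Submodule d.R K) {r a : K} (hr : r ∈ d.R) (ha : a ∈ N) : r * a ∈ N :=
  N.smul_mem (⟨r, hr⟩ : d.R) ha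

lemma mon_mul_mem_monGt {f : ℕ ⊕ ℕ →₀ ℕ} (hf : d.Valid f) {τ : ℝ} {a : K}
    (ha : a ∈ d.monGt τ) : d.mon f * a ∈ d.monGt (d.weight f + τ) := by
  induction ha using Submodule.span_induction with
  | mem a h =>
    obtain ⟨g, ⟨hg, h⟩, rfl⟩ := h
    rw [← mon_add]
    exact mon_mem_monGt (hf.add hg) (by rw [weight_add]; linarith)
  | zero => simp
  | add a b _ _ ha hb => rw [mul_add]; exact add_mem ha hb
  | smul r a _ ha => rw [mul_smul_comm]; exact Submodule.smul_mem _ _ ha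

lemma mon_mul_mem_monGt_of_pos {f : ℕ ⊕ ℕ →₀ ℕ} (hf : d.Valid f) (hpos : 0 < d.weight f)
    {τ : ℝ} {a : K} (ha : a ∈ d.monGe τ) : d.mon f * a ∈ d.monGt τ := by
  induction ha using Submodule.span_induction with
  | mem a h =>
    obtain ⟨g, ⟨hg, h⟩, rfl⟩ := h
    rw [← mon_add]
    exact mon_mem_monGt (hf.add hg) (by rw [weight_add]; linarith)
  | zero => simp
  | add a b _ _ ha hb => rw [mul_add]; exact add_mem ha hb
  | smul r a _ ha => rw [mul_smul_comm]; exact Submodule.smul_mem _ _ ha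

/-- Every element of `R` is a constant plus a combination of the regular parameters. -/
lemma exists_residue {r : K} (hr : r ∈ d.R) : ∃ c ∈ d.kk, ∃ a ∈ d.R, ∃ b ∈ d.R, ∃ e ∈ d.R,
    r = c + (d.x * a + d.y * b + d.z * e) := by
  by_cases hr0 : r = 0
  · exact ⟨0, d.kk.zero_mem, 0, d.R.zero_mem, 0, d.R.zero_mem, 0, d.R.zero_mem, by simp [hr0]⟩
  obtain ⟨c, hc, h⟩ := d.hres r hr0 (d.hdom r hr hr0)
  by_cases h0 : r - c = 0
  · exact ⟨c, hc, 0, d.R.zero_mem, 0, d.R.zero_mem, 0, d.R.zero_mem,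
      by simp [sub_eq_zero.1 h0]⟩
  · have hm := d.hparam (r - c) (sub_mem hr (d.hkR hc)) h0 (h.resolve_left h0)
    rw [Ideal.span, Submodule.mem_span_triple] at hm
    obtain ⟨a, b, e, h⟩ := hm
    refine ⟨c, hc, a, a.2, b, b.2, e, e.2, ?_⟩
    have h := congrArg (Subtype.val : d.R → K) h
    simp only [smul_eq_mul, Subring.coe_add, Subring.coe_mul] at h
    linear_combination -h

lemma weight_x : d.weight (Finsupp.single (Sum.inl 1) 1) = d.ν d.x := by
  rw [weight_single, val_eq adm_one]; simp [gen, d.hP1]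

lemma weight_y : d.weight (Finsupp.single (Sum.inl 2) 1) = d.ν d.y := by
  rw [weight_single, val_eq adm_two]; simp [gen, d.hP2]

lemma weight_z : d.weight (Finsupp.single (Sum.inr 1) 1) = d.ν d.z := by
  rw [weight_single, val_eq adm_z]; simp [gen, d.hT1]

lemma param_mul_mem_monGt {τ : ℝ} {h : K} (hh : h ∈ d.monGe τ) :
    d.x * h ∈ d.monGt τ ∧ d.y * h ∈ d.monGt τ ∧ d.z * h ∈ d.monGt τ := by
  have hx := d.hνx
  have hy := hx.trans_le d.hνxy
  have hz := hy.trans_le d.hνyz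
  refine ⟨?_, ?_, ?_⟩
  · simpa [gen, d.hP1] using
      mon_mul_mem_monGt_of_pos (valid_single (d := d) adm_one 1) (by rw [weight_x]; exact hx) hh
  · simpa [gen, d.hP2] using
      mon_mul_mem_monGt_of_pos (valid_single (d := d) adm_two 1) (by rw [weight_y]; exact hy) hh
  · simpa [gen, d.hT1] using
      mon_mul_mem_monGt_of_pos (valid_single (d := d) adm_z 1) (by rw [weight_z]; exact hz) hh

end RSetup

end Jump

namespace Jump

namespace RSetup

variable {K : Type} [Field K] {d : RSetup K}

/-- The chain `𝒯_i` of the construction. -/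
noncomputable abbrev TC (d : RSetup K) (i : ℕ) : Set PVec :=
  TchainR d.β d.γ d.q d.s d.m (fun n => d.T n = 0) i

/-- Comparison of exponent vectors at the largest index where they differ, all the `T`-indices
being larger than all the `P`-indices. -/
def TopLT (n g : ℕ ⊕ ℕ →₀ ℕ) : Prop :=
  Finsupp.Lex (fun a b => Sum.Lex (· < ·) (· < ·) b a) (· < ·) n g

lemma topLT_wf : WellFounded TopLT := by
  have : Std.Trichotomous (fun a b : ℕ ⊕ ℕ => Sum.Lex (· < ·) (· < ·) b a) :=
    inferInstanceAs (Std.Trichotomous (Function.swap (Sum.Lex (· < ·) (· < ·))))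
  exact Finsupp.Lex.wellFounded' (fun n => Nat.not_lt_zero n) wellFounded_lt
    (Sum.lex_wf wellFounded_lt wellFounded_lt)

lemma TopLT.add_left {n g : ℕ ⊕ ℕ →₀ ℕ} (h : TopLT n g) (f : ℕ ⊕ ℕ →₀ ℕ) :
    TopLT (f + n) (f + g) := by
  obtain ⟨i, h1, h2⟩ := h
  exact ⟨i, fun j hj => by simp [h1 j hj], by simpa using h2⟩

lemma TC_mono {i j : ℕ} (h : i ≤ j) : d.TC i ⊆ d.TC j := by
  induction h with
  | refl => exact subset_rfl
  | step _ ih => exact ih.trans Set.subset_union_left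

lemma TC_subset_TF (i : ℕ) : d.TC i ⊆ d.TF := Set.subset_iUnion d.TC i

lemma Dstep_subset_TF {i : ℕ} (hi : i ≠ 0) (hT : d.T i ≠ 0) :
    Dstep d.β d.γ d.s d.m i (d.TC i) ⊆ d.TF := by
  refine Set.Subset.trans ?_ (TC_subset_TF (i + 1))
  intro p hp
  right
  rwa [Astep, if_neg hi, if_neg hT]

lemma unit_mem_TC {i : ℕ} (hi : i ≠ 0) (hT : d.T i = 0) :
    ((fun _ => 0, unitVec i) : PVec) ∈ d.TC (i + 1) := by
  right
  rw [Astep, if_neg hi, if_pos hT]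
  rfl

lemma Pset_subset_TF : Pset d.q ⊆ d.TF := TC_subset_TF 0

lemma mem_TF {p : PVec} (hp : p ∈ d.TF) : p ∈ Pset d.q ∨ ∃ i, 1 ≤ i ∧
    ((d.T i = 0 ∧ p = (fun _ => 0, unitVec i)) ∨
      (d.T i ≠ 0 ∧ p ∈ Dstep d.β d.γ d.s d.m i (d.TC i))) := by
  obtain ⟨n, hn⟩ := Set.mem_iUnion.1 hp
  induction n with
  | zero => exact Or.inl hn
  | succ n ih =>
    rcases hn with hn | hn
    · exact ih hn
    · right
      rw [Astep] at hn
      split_ifs at hn with h1 h2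
      · exact hn.elim
      · exact ⟨n, Nat.one_le_iff_ne_zero.2 h1, Or.inl ⟨h2, hn⟩⟩
      · exact ⟨n, Nat.one_le_iff_ne_zero.2 h1, Or.inr ⟨h2, hn⟩⟩

lemma sInf_spec {p : ℕ → Prop} {u : ℕ∞}
    (hu : u = sInf {x : ℕ∞ | ∃ t : ℕ, x = (t : ℕ∞) ∧ 0 < t ∧ p t}) :
    (∀ t : ℕ, u = t → 0 < t ∧ p t) ∧ (∀ t : ℕ, 0 < t → p t → u ≤ t) := by
  refine ⟨fun t ht => ?_, fun t h0 hp => hu ▸ sInf_le ⟨t, rfl, h0, hp⟩⟩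
  have hne : {x : ℕ∞ | ∃ t : ℕ, x = (t : ℕ∞) ∧ 0 < t ∧ p t}.Nonempty := by
    by_contra h
    rw [Set.not_nonempty_iff_eq_empty.1 h, sInf_empty, ht] at hu
    exact ENat.natCast_ne_top t hu
  obtain ⟨t2, h1, h2⟩ := csInf_mem hne
  rw [← hu, ht, Nat.cast_inj] at h1
  exact h1 ▸ h2

lemma q_spec {j t : ℕ} (hj : 2 ≤ j) (hq : d.q j = t) :
    (j : ℕ∞) ≤ d.len ∧ ((j + 1 : ℕ) : ℕ∞) ≤ d.len ∧ 0 < t := by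
  have h1 : (j : ℕ∞) ≤ d.len := by
    by_contra h
    rw [d.hqtop j (not_le.1 h)] at hq
    exact ENat.natCast_ne_top t hq.symm
  refine ⟨h1, ?_, ((sInf_spec (d.hq j hj h1)).1 t hq).1⟩
  have h2 : d.len ≠ j := fun h => by
    rw [(d.hlast j hj h1).2 h] at hq
    exact ENat.natCast_ne_top t hq.symm
  have h3 := Order.add_one_le_of_lt (lt_of_le_of_ne h1 h2.symm)
  exact_mod_cast h3

lemma single_of_toPair {g : ℕ ⊕ ℕ →₀ ℕ} {j t : ℕ}
    (h : toPair g = (fun l => t * unitVec j l, fun _ => 0)) :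
    g = Finsupp.single (Sum.inl j) t := by
  classical
  apply toPair_injective
  rw [h]
  ext l
  · by_cases hl : l = j
    · simp [toPair, unitVec, hl]
    · simp [toPair, unitVec, hl, Finsupp.single_apply, Ne.symm hl]
  · simp [toPair]

/-- The jumping recursions replace a monomial in `𝒯` by an earlier monomial of the same weight. -/
lemma exists_rewrite {g : ℕ ⊕ ℕ →₀ ℕ} (hg : d.Valid g) (hgT : toPair g ∈ d.TF) :
    ∃ c ∈ d.kk, ∃ n, d.Valid n ∧ d.weight n = d.weight g ∧ TopLT n g ∧
      d.mon g - c * d.mon n ∈ d.monGt (d.weight g) := by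
  rcases mem_TF hgT with ⟨j, hj, t, hq, hp⟩ | ⟨i, hi, ⟨hT, hp⟩ | ⟨hT, hp⟩⟩
  · obtain ⟨hjl, hjl1, ht⟩ := q_spec hj hq
    obtain rfl := single_of_toPair hp
    obtain ⟨lam, LL, hlam, -, hLL, -, hw, hP, hν⟩ := d.hPrec j hj hjl t hq
    obtain ⟨n, hn⟩ := exists_toPair (A := LL) (C := fun _ => 0) hLL (i := 0) (fun _ _ => rfl)
    have h0 : Supp 0 (fun _ => 0) := fun _ _ => rfl
    have hnl : ∀ l, n (Sum.inl l) = LL l := fun l => congrFun (congrArg Prod.fst hn) l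
    have hnr : ∀ l, n (Sum.inr l) = 0 := fun l => congrFun (congrArg Prod.snd hn) l
    have hmg : d.mon (Finsupp.single (Sum.inl j) t) = d.P j ^ t := by simp [gen]
    have hwg : d.weight (Finsupp.single (Sum.inl j) t) = t * d.β j := by simp [val]
    have hmn : d.mon n = ∏ l ∈ Finset.Icc 1 (j - 1), d.P l ^ LL l := by
      rw [mon_eq d hLL h0 hn]; simp [Pm, Tm]
    have hwn : d.weight n = t * d.β j := by
      rw [weight_eq d hLL h0 hn, hw]; simp [wt, wtA]
    refine ⟨lam, hlam, n, ?_, by rw [hwn, hwg], ?_, ?_⟩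
    · rintro (l | l) hl
      · rw [hnl] at hl
        have hl2 : ¬ (l = 0 ∨ j - 1 < l) := fun h => hl (hLL l h)
        refine ⟨by omega, le_trans ?_ hjl⟩
        exact_mod_cast (by omega : l ≤ j)
      · exact absurd (hnr l) hl
    · refine ⟨Sum.inl j, ?_, ?_⟩
      · rintro (l | l) hl
        · have hl : j < l := by simpa using hl
          rw [hnl, hLL l (by omega), Finsupp.single_apply, if_neg (by simp; omega)]
        · rw [hnr, Finsupp.single_apply, if_neg (by simp)]
      · rw [hnl, hLL j (by omega), Finsupp.single_eq_same]
        exact ht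
    · have hadm : d.Adm (Sum.inl (j + 1)) := ⟨by omega, hjl1⟩
      rw [hmg, hmn, ← hP, hwg]
      have := mon_mem_monGt (τ := t * d.β j) (valid_single hadm 1)
        (by rw [weight_single, val_eq hadm]; simpa [gen] using hν)
      simpa [gen] using this
  · have h1 : g (Sum.inr i) = unitVec i i := congrFun (congrArg Prod.snd hp) i
    exact absurd hT (hg (Sum.inr i) (by rw [h1]; simp [unitVec])).2
  · have hs : d.s i ≠ ⊤ := fun h => by
      rw [Dstep, if_pos h] at hp
      exact hp
    have hp2 := hp
    rw [Dstep, if_neg hs] at hp2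
    obtain ⟨hA, hC, -, ⟨hpos, -⟩, -⟩ := hp2
    obtain ⟨e, -, he⟩ := d.hTrec i hi hT hs
    have hpD : toPair g ∈ DsetR d.β d.γ d.s d.m (fun n => d.T n = 0) i (d.TC i) := by
      rw [DsetR, if_neg hT]; exact hp
    obtain ⟨LL, NN, mu, hLL, hNN, hirr, hw, hmu, -, hTn, hν⟩ := he ⟨_, hpD⟩
    obtain ⟨n, hn⟩ := exists_toPair hLL hNN
    have hnl : ∀ l, n (Sum.inl l) = LL l := fun l => congrFun (congrArg Prod.fst hn) l
    have hnr : ∀ l, n (Sum.inr l) = NN l := fun l => congrFun (congrArg Prod.snd hn) l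
    generalize hN : (∑ j ∈ Finset.range i, d.δ j) + ((e ⟨_, hpD⟩ : Fin (d.δ i)) : ℕ) + 1 = N
      at hTn hν
    have hwg : d.weight g = wt d.β d.γ (d.m i) i (toPair g) := weight_eq d hA hC rfl
    refine ⟨mu, hmu, n, ?_, ?_, ?_, ?_⟩
    · rintro (l | l) hl
      · rw [hnl] at hl
        have hl2 : ¬ (l = 0 ∨ d.m i < l) := fun h => hl (hLL l h)
        refine ⟨by omega, le_trans ?_ (d.hmlen i).2⟩
        exact_mod_cast (by omega : l ≤ d.m i)
      · rw [hnr] at hl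
        have hl2 : ¬ (l = 0 ∨ i - 1 < l) := fun h => hl (hNN l h)
        refine ⟨by omega, fun hTl => ?_⟩
        refine hirr _ (TC_mono (by omega) (unit_mem_TC (by omega) hTl)) ⟨fun _ => Nat.zero_le _, ?_⟩
        intro l2
        by_cases h : l2 = l
        · subst h; simp only [unitVec, if_true]; omega
        · simp [unitVec, h]
    · rw [weight_eq d hLL hNN hn, hw, hwg]
    · refine ⟨Sum.inr i, ?_, ?_⟩
      · rintro (l | l) hl
        · simp at hl
        · have hl : i < l := by simpa using hl
          rw [hnr, hNN l (by omega)]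
          exact (hC l (by omega)).symm
      · rw [hnr, hNN i (by omega)]
        exact hpos
    · have hmg : d.mon g - mu * d.mon n = d.T N := by
        rw [hTn, mon_eq d hA hC rfl, mon_eq d hLL hNN hn, mul_assoc mu]
        rfl
      rw [hmg, hwg]
      by_cases hTN : d.T N = 0
      · rw [hTN]; exact zero_mem _
      · have hadm : d.Adm (Sum.inr N) := ⟨by omega, hTN⟩
        have := mon_mem_monGt (τ := wt d.β d.γ (d.m i) i (toPair g)) (valid_single hadm 1)
          (by rw [weight_single, val_eq hadm]; simpa [gen] using hν.resolve_left hTN)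
        simpa [gen] using this

lemma irr_mono {T : Set PVec} {f g : ℕ ⊕ ℕ →₀ ℕ} (hf : Irr T (toPair f)) (hg : g ≤ f) :
    Irr T (toPair g) := fun bd hbd h =>
  hf bd hbd ⟨h.1.trans fun l => hg (Sum.inl l), h.2.trans fun l => hg (Sum.inr l)⟩

lemma exists_of_le_toPair {f : ℕ ⊕ ℕ →₀ ℕ} {p : PVec} (h1 : p.1 ≤ (toPair f).1)
    (h2 : p.2 ≤ (toPair f).2) : ∃ g ≤ f, toPair g = p := by
  refine ⟨Finsupp.onFinset f.support (Sum.elim p.1 p.2) ?_, ?_, rfl⟩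
  · rintro (l | l) hl
    · exact Finsupp.mem_support_iff.2 fun h => hl (Nat.le_zero.1 (h ▸ h1 l))
    · exact Finsupp.mem_support_iff.2 fun h => hl (Nat.le_zero.1 (h ▸ h2 l))
  · rintro (l | l)
    · exact h1 l
    · exact h2 l

/-- Every monomial is congruent to a multiple of an irreducible monomial of the same weight. -/
lemma exists_irr {f : ℕ ⊕ ℕ →₀ ℕ} (hf : d.Valid f) :
    ∃ c ∈ d.kk, ∃ n, d.Valid n ∧ Irr d.TF (toPair n) ∧ d.weight n = d.weight f ∧
      d.mon f - c * d.mon n ∈ d.monGt (d.weight f) := by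
  induction f using topLT_wf.induction with
  | _ f ih =>
  by_cases hirr : Irr d.TF (toPair f)
  · exact ⟨1, d.kk.one_mem, f, hf, hirr, rfl, by simp⟩
  · simp only [Irr, not_forall, not_not] at hirr
    obtain ⟨bd, hbd, h1, h2⟩ := hirr
    obtain ⟨g, hgf, rfl⟩ := exists_of_le_toPair h1 h2
    obtain ⟨h, rfl⟩ := exists_add_of_le hgf
    rw [add_comm g h] at hf ih ⊢
    have hg : d.Valid g := hf.mono le_add_self
    have hh : d.Valid h := hf.mono le_self_add
    obtain ⟨c, hc, n, hn, hwn, hlt, hmem⟩ := exists_rewrite hg hbd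
    have hw : d.weight (h + n) = d.weight (h + g) := by rw [weight_add, weight_add, hwn]
    obtain ⟨c2, hc2, n2, hn2, hirr2, hwn2, hmem2⟩ := ih (h + n) (hlt.add_left h) (hh.add hn)
    rw [hw] at hwn2 hmem2
    refine ⟨c * c2, d.kk.mul_mem hc hc2, n2, hn2, hirr2, hwn2, ?_⟩
    have h3 := mon_mul_mem_monGt hh hmem
    rw [← weight_add] at h3
    have h4 := add_mem h3 (smul_mem_of_mem _ (d.hkR hc) hmem2)
    convert h4 using 1
    rw [mon_add, mon_add]
    ring

end RSetup

end Jump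

namespace Jump

/-- The subgroup generated by `β_1, …, β_n`. -/
def grpOne (β : ℕ → ℝ) (n : ℕ) : AddSubgroup ℝ := AddSubgroup.closure (β '' Set.Icc 1 n)

lemma grpOne_mono (β : ℕ → ℝ) {n k : ℕ} (h : n ≤ k) : grpOne β n ≤ grpOne β k :=
  AddSubgroup.closure_mono (Set.image_mono (Set.Icc_subset_Icc_right h))

lemma mem_grpOne (β : ℕ → ℝ) {j n : ℕ} (h1 : 1 ≤ j) (h2 : j ≤ n) : β j ∈ grpOne β n :=
  AddSubgroup.subset_closure ⟨j, ⟨h1, h2⟩, rfl⟩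

lemma mem_Gr {β : ℕ → ℝ} {n : ℕ} {x : ℝ} : x ∈ Gr β n ↔ x ∈ grpOne β n := by
  classical
  constructor
  · rintro ⟨A, -, rfl⟩
    refine sum_mem fun j hj => ?_
    rw [Finset.mem_Icc] at hj
    rw [← zsmul_eq_mul]
    exact zsmul_mem (mem_grpOne β hj.1 hj.2) _
  · intro hx
    induction hx using AddSubgroup.closure_induction with
    | mem x h =>
      obtain ⟨j, ⟨h1, h2⟩, rfl⟩ := h
      refine ⟨Pi.single j 1, fun l hl => ?_, ?_⟩
      · rw [Pi.single_apply, if_neg (by omega)]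
      · simp [wtZ, Pi.single_apply, h1, h2]
    | zero => exact ⟨0, fun _ _ => rfl, by simp [wtZ]⟩
    | add x y _ _ hx hy =>
      obtain ⟨A, hA, rfl⟩ := hx
      obtain ⟨B, hB, rfl⟩ := hy
      refine ⟨A + B, fun l hl => by simp [hA l hl, hB l hl], ?_⟩
      simp [wtZ, ← Finset.sum_add_distrib, add_mul]
    | neg x _ hx =>
      obtain ⟨A, hA, rfl⟩ := hx
      exact ⟨-A, fun l hl => by simp [hA l hl], by simp [wtZ]⟩

lemma mem_GrH {β γ : ℕ → ℝ} {k i : ℕ} {x : ℝ} :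
    x ∈ GrH β γ k i ↔ x ∈ grpOne β k ⊔ grpOne γ i := by
  simp only [GrH, Set.mem_ofPred_eq, mem_Gr, AddSubgroup.mem_sup, eq_comm]

lemma grpOne_zero (β : ℕ → ℝ) : grpOne β 0 = ⊥ := by
  simp [grpOne]

lemma exists_sub_mem {β γ : ℕ → ℝ} {n i : ℕ} {x : ℝ}
    (hx : x ∈ grpOne β n ⊔ grpOne γ (i + 1)) :
    ∃ c : ℤ, x - c * γ (i + 1) ∈ grpOne β n ⊔ grpOne γ i := by
  have h : grpOne γ (i + 1) = grpOne γ i ⊔ AddSubgroup.closure {γ (i + 1)} := by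
    rw [grpOne, grpOne, ← AddSubgroup.closure_union, ← Set.image_singleton, ← Set.image_union]
    congr 2
    ext l
    simp only [Set.mem_Icc, Set.mem_union, Set.mem_singleton_iff]
    omega
  rw [h, ← sup_assoc] at hx
  obtain ⟨y, hy, z, hz, rfl⟩ := AddSubgroup.mem_sup.1 hx
  obtain ⟨c, rfl⟩ := AddSubgroup.mem_closure_singleton.1 hz
  exact ⟨c, by simpa using hy⟩

lemma natAbs_mul_mem {G : AddSubgroup ℝ} {c : ℤ} {x : ℝ} (h : (c : ℝ) * x ∈ G) :
    (c.natAbs : ℝ) * x ∈ G := by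
  rcases Int.natAbs_eq c with h1 | h1
  · rw [h1] at h; simpa using h
  · rw [h1] at h; simpa using h

lemma exists_last {Q : ℕ → Prop} {N : ℕ} (hb : ∀ l, N < l → ¬ Q l) (hne : ∃ l, Q l) :
    ∃ l, Q l ∧ ∀ j, l < j → ¬ Q j := by
  have hbd : BddAbove {l | Q l} := ⟨N, fun l hl => not_lt.1 fun h => hb l h hl⟩
  exact ⟨sSup {l | Q l}, Nat.sSup_mem hne hbd, fun j hj h => (le_csSup hbd h).not_gt hj⟩

namespace RSetup

variable {K : Type} [Field K] {d : RSetup K}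

lemma mem_GH {k i : ℕ} {x : ℝ} (hk : (k : ℕ∞) ≤ d.len)
    (hx : x ∈ grpOne d.β k ⊔ grpOne d.γ i) : x ∈ GH d.β d.γ d.len i :=
  ⟨k, hk, mem_GrH.2 hx⟩

lemma m_mono {i j : ℕ} (h : i ≤ j) : d.m i ≤ d.m j := by
  induction h with
  | refl => exact le_rfl
  | @step j _ ih =>
    refine ih.trans ?_
    have h1 : 1 ≤ j + 1 := by omega
    by_cases hT : d.T (j + 1) = 0
    · exact ((d.hsz _ h1 hT).2).ge
    · cases hs : d.s (j + 1) with
      | top => exact (d.hmtop _ h1 hT hs).ge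
      | coe t => rw [Nat.succ_eq_add_one, d.hmfin _ h1 hT t hs]; exact le_max_left _ _

lemma s_mul_mem {i t : ℕ} (hi : 1 ≤ i) (hT : d.T i ≠ 0) (hs : d.s i = t) :
    (t : ℝ) * d.γ i ∈ grpOne d.β (d.m i) ⊔ grpOne d.γ (i - 1) := by
  obtain ⟨-, k, hk, hmem⟩ := (sInf_spec (d.hs i hi hT)).1 t hs
  have hne : {j : ℕ | 1 ≤ j ∧ (j : ℕ∞) ≤ d.len ∧
      (t : ℝ) * d.γ i ∈ GrH d.β d.γ j (i - 1)}.Nonempty := by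
    refine ⟨max k 1, le_max_right _ _, ?_, ?_⟩
    · rcases max_choice k 1 with h | h <;> rw [h]
      · exact hk
      · exact adm_one.2
    · rw [mem_GrH] at hmem ⊢
      exact sup_le_sup_right (grpOne_mono _ (le_max_left _ _)) _ hmem
  have h2 := (Nat.sInf_mem hne).2.2
  rw [mem_GrH] at h2
  refine sup_le_sup_right (grpOne_mono _ ?_) _ h2
  rw [d.hmfin i hi hT t hs]
  exact le_max_right _ _

lemma mul_gamma_mem {i k : ℕ} (hi : 1 ≤ i) (hk : (k : ℕ∞) ≤ d.len) {c : ℤ}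
    (hc : (c : ℝ) * d.γ i ∈ grpOne d.β k ⊔ grpOne d.γ (i - 1)) :
    (c : ℝ) * d.γ i ∈ grpOne d.β (d.m i) ⊔ grpOne d.γ (i - 1) := by
  by_cases hT : d.T i = 0
  · rw [(d.hγ i hi).1 hT, mul_zero]; exact zero_mem _
  by_cases hc0 : c = 0
  · simp [hc0]
  have hspec := sInf_spec (d.hs i hi hT)
  cases hs : d.s i with
  | top =>
    have := hspec.2 c.natAbs (Int.natAbs_pos.2 hc0) (mem_GH hk (natAbs_mul_mem hc))
    rw [hs] at this
    exact absurd (top_le_iff.1 this) (ENat.natCast_ne_top _)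
  | coe t =>
    have hmem := s_mul_mem hi hT hs
    have ht := (hspec.1 t hs).1
    have hquot : ((c / t : ℤ) : ℝ) * ((t : ℝ) * d.γ i) ∈
        grpOne d.β (d.m i) ⊔ grpOne d.γ (i - 1) := by
      rw [← zsmul_eq_mul]; exact zsmul_mem hmem _
    have hdiv : (c : ℝ) = ((c / t : ℤ) : ℝ) * t + ((c % t : ℤ) : ℝ) := by
      exact_mod_cast (Int.ediv_mul_add_emod c t).symm
    have hmod : c % t = 0 := by
      by_contra h0
      have hlt := Int.emod_lt_of_pos c (Int.natCast_pos.2 ht)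
      have hnn := Int.emod_nonneg c (Int.natCast_ne_zero.2 ht.ne')
      have hM : ((max k (d.m i) : ℕ) : ℕ∞) ≤ d.len := by
        rcases max_choice k (d.m i) with h | h <;> rw [h]
        · exact hk
        · exact (d.hmlen i).2
      have h1 : ((c % t : ℤ) : ℝ) * d.γ i ∈
          grpOne d.β (max k (d.m i)) ⊔ grpOne d.γ (i - 1) := by
        have h2 : ((c % t : ℤ) : ℝ) * d.γ i =
            c * d.γ i - ((c / t : ℤ) : ℝ) * ((t : ℝ) * d.γ i) := by rw [hdiv]; ring
        rw [h2]
        exact sub_mem (sup_le_sup_right (grpOne_mono _ (le_max_left _ _)) _ hc)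
          (sup_le_sup_right (grpOne_mono _ (le_max_right _ _)) _ hquot)
      have h2 := hspec.2 _ (Int.natAbs_pos.2 h0) (mem_GH hM (natAbs_mul_mem h1))
      rw [hs, Nat.cast_le] at h2
      omega
    rw [hdiv, hmod]
    convert hquot using 1
    push_cast
    ring

lemma mem_grpOne_of_mem_sup {n k : ℕ} (hnk : n ≤ k) (hk : (k : ℕ∞) ≤ d.len) {x : ℝ}
    (hx : x ∈ grpOne d.β k) (i : ℕ) (hi : d.m i ≤ n)
    (hxi : x ∈ grpOne d.β n ⊔ grpOne d.γ i) : x ∈ grpOne d.β n := by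
  induction i with
  | zero => simpa [grpOne_zero] using hxi
  | succ i ih =>
    refine ih ((m_mono (Nat.le_succ i)).trans hi) ?_
    obtain ⟨c, hc⟩ := exists_sub_mem hxi
    have h1 : (c : ℝ) * d.γ (i + 1) ∈ grpOne d.β k ⊔ grpOne d.γ i := by
      have := sub_mem ((le_sup_left : _ ≤ grpOne d.β k ⊔ grpOne d.γ i) hx)
        (sup_le_sup_right (grpOne_mono _ hnk) _ hc)
      simpa using this
    have h2 := sup_le_sup_right (grpOne_mono d.β hi) _ (mul_gamma_mem (by omega) hk h1)
    have := add_mem hc h2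
    simpa using this

lemma weight_mem {f : ℕ ⊕ ℕ →₀ ℕ} (hf : d.Valid f) {k i : ℕ}
    (hk : ∀ l, k < l → f (Sum.inl l) = 0) (hi : ∀ l, i < l → f (Sum.inr l) = 0) :
    d.weight f ∈ grpOne d.β k ⊔ grpOne d.γ i := by
  refine sum_mem fun j hj => ?_
  change (f j : ℝ) * d.val j ∈ _
  rw [← nsmul_eq_mul]
  refine nsmul_mem ?_ _
  have hj := Finsupp.mem_support_iff.1 hj
  rcases j with l | l
  · exact (le_sup_left : grpOne d.β k ≤ _)
      (mem_grpOne _ (hf _ hj).1 (not_lt.1 fun h => hj (hk l h)))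
  · exact (le_sup_right : grpOne d.γ i ≤ _)
      (mem_grpOne _ (hf _ hj).1 (not_lt.1 fun h => hj (hi l h)))

lemma supp_of_valid {f : ℕ ⊕ ℕ →₀ ℕ} (hf : d.Valid f) {k i : ℕ}
    (hk : ∀ l, k < l → f (Sum.inl l) = 0) (hi : ∀ l, i < l → f (Sum.inr l) = 0) :
    Supp k (toPair f).1 ∧ Supp i (toPair f).2 := by
  constructor
  · rintro l (rfl | hl)
    · by_contra h
      exact absurd (hf _ h).1 (by norm_num)
    · exact hk l hl
  · rintro l (rfl | hl)
    · by_contra h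
      exact absurd (hf _ h).1 (by norm_num)
    · exact hi l hl

/-- A monomial pushing `γ_i` is reducible. -/
lemma not_irr_of_push {f : ℕ ⊕ ℕ →₀ ℕ} {i : ℕ} (hi : 1 ≤ i) (hT : d.T i ≠ 0) (hs : d.s i ≠ ⊤)
    (hk : Supp (d.m i) (toPair f).1) (hC : Supp i (toPair f).2)
    (hp : Push d.β d.γ (d.m i) i (toPair f)) : ¬ Irr d.TF (toPair f) := by
  intro hirr
  obtain ⟨g, ⟨hgf, hg⟩, hmin⟩ := WellFounded.has_min
    (wellFounded_lt : WellFounded ((· < ·) : (ℕ ⊕ ℕ →₀ ℕ) → _ → Prop))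
    {g | g ≤ f ∧ Push d.β d.γ (d.m i) i (toPair g)} ⟨f, le_rfl, hp⟩
  have hgirr := irr_mono hirr hgf
  refine hgirr (toPair g) (Dstep_subset_TF (by omega) hT ?_) ⟨le_rfl, le_rfl⟩
  rw [Dstep, if_neg hs]
  refine ⟨fun l hl => ?_, fun l hl => ?_, fun bd hbd => hgirr bd (TC_subset_TF i hbd), hg, ?_⟩
  · exact Nat.le_zero.1 ((hgf (Sum.inl l)).trans (hk l hl).le)
  · exact Nat.le_zero.1 ((hgf (Sum.inr l)).trans (hC l hl).le)
  · intro p h1 h2 hne hpush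
    obtain ⟨h, hhg, rfl⟩ := exists_of_le_toPair h1 h2
    exact hmin h ⟨hhg.trans hgf, hpush⟩ (lt_of_le_of_ne hhg fun he => hne (he ▸ rfl))

lemma no_last_P {f g : ℕ ⊕ ℕ →₀ ℕ} (hf : d.Valid f) (hg : d.Valid g)
    (hirr : Irr d.TF (toPair f)) (hw : d.weight f = d.weight g) {k i : ℕ} (hk : 2 ≤ k)
    (hm : d.m i ≤ k - 1) (hfk : f (Sum.inl k) ≠ 0) (hgk : g (Sum.inl k) = 0)
    (hf1 : ∀ l, k < l → f (Sum.inl l) = 0) (hg1 : ∀ l, k < l → g (Sum.inl l) = 0)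
    (hf2 : ∀ l, i < l → f (Sum.inr l) = 0) (hg2 : ∀ l, i < l → g (Sum.inr l) = 0) : False := by
  classical
  obtain ⟨-, hlen⟩ := hf _ hfk
  have hfe : d.weight (f.erase (Sum.inl k)) + f (Sum.inl k) * d.β k = d.weight f := by
    conv_rhs => rw [← Finsupp.erase_add_single (Sum.inl k) f, weight_add, weight_single]
    rfl
  have hle : f.erase (Sum.inl k) ≤ f := by
    intro j
    rw [Finsupp.erase_apply]
    split_ifs <;> simp
  have h1 := weight_mem (hf.mono hle) (k := k - 1) (i := i)
    (fun l hl => by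
      rw [Finsupp.erase_apply]
      split_ifs with h
      · rfl
      · exact hf1 l (by simp only [Sum.inl.injEq] at h; omega))
    (fun l hl => Nat.le_zero.1 ((hle _).trans (hf2 l hl).le))
  have h2 := weight_mem hg (k := k - 1) (i := i)
    (fun l hl => by
      by_cases h : l = k
      · rw [h, hgk]
      · exact hg1 l (by omega)) hg2
  have h3 : (f (Sum.inl k) : ℝ) * d.β k ∈ grpOne d.β (k - 1) ⊔ grpOne d.γ i := by
    have := sub_mem h2 h1
    rwa [← hw, ← hfe, add_sub_cancel_left] at this
  have h4 : (f (Sum.inl k) : ℝ) * d.β k ∈ grpOne d.β k := by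
    rw [← nsmul_eq_mul]
    exact nsmul_mem (mem_grpOne _ (by omega) le_rfl) _
  have h5 := mem_grpOne_of_mem_sup (Nat.sub_le k 1) hlen h4 i hm h3
  have h6 := (sInf_spec (d.hq k hk hlen)).2 _ (Nat.pos_of_ne_zero hfk) (mem_Gr.2 h5)
  cases hq : d.q k with
  | top =>
    rw [hq] at h6
    exact absurd (top_le_iff.1 h6) (ENat.natCast_ne_top _)
  | coe t =>
    rw [hq, Nat.cast_le] at h6
    refine hirr _ (Pset_subset_TF ⟨k, hk, t, hq, rfl⟩) ⟨fun l => ?_, fun _ => Nat.zero_le _⟩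
    by_cases h : l = k
    · subst h; simpa [unitVec, toPair] using h6
    · simp [unitVec, h]

lemma exists_bound (f : ℕ ⊕ ℕ →₀ ℕ) :
    ∃ N, (∀ l, N < l → f (Sum.inl l) = 0) ∧ (∀ l, N < l → f (Sum.inr l) = 0) := by
  refine ⟨f.support.sup (Sum.elim id id), fun l hl => ?_, fun l hl => ?_⟩ <;>
  · by_contra h
    exact (Finset.le_sup (f := Sum.elim id id) (Finsupp.mem_support_iff.2 h)).not_gt hl

lemma eq_zero_of_lt_P {f g : ℕ ⊕ ℕ →₀ ℕ} (hf : d.Valid f) (hg : d.Valid g)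
    (hfi : Irr d.TF (toPair f)) (hgi : Irr d.TF (toPair g)) (hw : d.weight f = d.weight g)
    (hdisj : ∀ j, f j = 0 ∨ g j = 0) {i : ℕ}
    (hf2 : ∀ l, i < l → f (Sum.inr l) = 0) (hg2 : ∀ l, i < l → g (Sum.inr l) = 0) :
    (∀ l, d.m i < l → f (Sum.inl l) = 0) ∧ (∀ l, d.m i < l → g (Sum.inl l) = 0) := by
  suffices h : ¬ ∃ l, d.m i < l ∧ (f (Sum.inl l) ≠ 0 ∨ g (Sum.inl l) ≠ 0) by
    push Not at h
    exact ⟨fun l hl => (h l hl).1, fun l hl => (h l hl).2⟩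
  intro hne
  obtain ⟨N, hN, -⟩ := exists_bound f
  obtain ⟨M, hM, -⟩ := exists_bound g
  obtain ⟨k, ⟨hmk, hk⟩, hlast⟩ := exists_last (N := max N M) (fun l hl h => by
    rcases h.2 with h | h
    · exact h (hN l (lt_of_le_of_lt (le_max_left _ _) hl))
    · exact h (hM l (lt_of_le_of_lt (le_max_right _ _) hl))) hne
  have hm1 := (d.hmlen i).1
  have hlast2 : ∀ l, k < l → f (Sum.inl l) = 0 ∧ g (Sum.inl l) = 0 := fun l hl => by
    have := hlast l hl
    push Not at this
    exact this (by omega)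
  rcases hk with hk | hk
  · exact no_last_P hf hg hfi hw (by omega) (i := i) (by omega) hk
      ((hdisj (Sum.inl k)).resolve_left hk) (fun l hl => (hlast2 l hl).1)
      (fun l hl => (hlast2 l hl).2) hf2 hg2
  · exact no_last_P hg hf hgi hw.symm (by omega) (i := i) (by omega) hk
      ((hdisj (Sum.inl k)).resolve_right hk) (fun l hl => (hlast2 l hl).2)
      (fun l hl => (hlast2 l hl).1) hg2 hf2

lemma no_last_T {f g : ℕ ⊕ ℕ →₀ ℕ} (hf : d.Valid f) (hg : d.Valid g)
    (hfi : Irr d.TF (toPair f)) (hgi : Irr d.TF (toPair g)) (hw : d.weight f = d.weight g)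
    (hdisj : ∀ j, f j = 0 ∨ g j = 0) {i : ℕ} (hfn : f (Sum.inr i) ≠ 0)
    (hf2 : ∀ l, i < l → f (Sum.inr l) = 0) (hg2 : ∀ l, i < l → g (Sum.inr l) = 0) : False := by
  classical
  obtain ⟨hi, hT⟩ := hf _ hfn
  obtain ⟨hf1, hg1⟩ := eq_zero_of_lt_P hf hg hfi hgi hw hdisj hf2 hg2
  have hgn : g (Sum.inr i) = 0 := (hdisj _).resolve_left hfn
  have hg3 : ∀ l, i - 1 < l → g (Sum.inr l) = 0 := fun l hl => by
    by_cases h : l = i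
    · rw [h, hgn]
    · exact hg2 l (by omega)
  obtain ⟨hfA, hfC⟩ := supp_of_valid hf hf1 hf2
  obtain ⟨hgA, hgC⟩ := supp_of_valid hg hg1 hg3
  have hle : f.erase (Sum.inr i) ≤ f := by
    intro j
    rw [Finsupp.erase_apply]
    split_ifs <;> simp
  have hfe : d.weight (f.erase (Sum.inr i)) + f (Sum.inr i) * d.γ i = d.weight f := by
    conv_rhs => rw [← Finsupp.erase_add_single (Sum.inr i) f, weight_add, weight_single]
    rfl
  have h1 := weight_mem (hf.mono hle) (k := d.m i) (i := i - 1)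
    (fun l hl => Nat.le_zero.1 ((hle _).trans (hf1 l hl).le))
    (fun l hl => by
      rw [Finsupp.erase_apply]
      split_ifs with h
      · rfl
      · exact hf2 l (by simp only [Sum.inr.injEq] at h; omega))
  have h2 := weight_mem hg hg1 hg3
  have h3 : (f (Sum.inr i) : ℝ) * d.γ i ∈ grpOne d.β (d.m i) ⊔ grpOne d.γ (i - 1) := by
    have := sub_mem h2 h1
    rwa [← hw, ← hfe, add_sub_cancel_left] at this
  have h6 := (sInf_spec (d.hs i hi hT)).2 _ (Nat.pos_of_ne_zero hfn) (mem_GH (d.hmlen i).2 h3)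
  refine not_irr_of_push hi hT (fun h => ?_) hfA hfC ⟨Nat.pos_of_ne_zero hfn, ?_⟩ hfi
  · rw [h] at h6
    exact absurd (top_le_iff.1 h6) (ENat.natCast_ne_top _)
  · rw [← weight_eq d hfA hfC rfl, hw, weight_eq d hgA hgC rfl]
    exact ⟨_, ⟨_, hgA, rfl⟩, _, ⟨_, hgC, rfl⟩, rfl⟩

/-- Disjoint irreducible exponent vectors of the same weight vanish. -/
lemma eq_zero_of_disjoint {f g : ℕ ⊕ ℕ →₀ ℕ} (hf : d.Valid f) (hg : d.Valid g)
    (hfi : Irr d.TF (toPair f)) (hgi : Irr d.TF (toPair g)) (hw : d.weight f = d.weight g)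
    (hdisj : ∀ j, f j = 0 ∨ g j = 0) : f = g := by
  have hr : ∀ l, f (Sum.inr l) = 0 ∧ g (Sum.inr l) = 0 := by
    by_contra hne
    push Not at hne
    have hne2 : ∃ l, f (Sum.inr l) ≠ 0 ∨ g (Sum.inr l) ≠ 0 := by
      obtain ⟨l, hl⟩ := hne
      exact ⟨l, or_iff_not_imp_left.2 fun h => hl (not_not.1 h)⟩
    obtain ⟨N, -, hN⟩ := exists_bound f
    obtain ⟨M, -, hM⟩ := exists_bound g
    obtain ⟨k, hk, hlast⟩ := exists_last (N := max N M) (fun l hl h => by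
      rcases h with h | h
      · exact h (hN l (lt_of_le_of_lt (le_max_left _ _) hl))
      · exact h (hM l (lt_of_le_of_lt (le_max_right _ _) hl))) hne2
    push Not at hlast
    rcases hk with hk | hk
    · exact no_last_T hf hg hfi hgi hw hdisj hk (fun l hl => (hlast l hl).1)
        (fun l hl => (hlast l hl).2)
    · exact no_last_T hg hf hgi hfi hw.symm (fun j => (hdisj j).symm) hk
        (fun l hl => (hlast l hl).2) (fun l hl => (hlast l hl).1)
  have hl := eq_zero_of_lt_P hf hg hfi hgi hw hdisj (i := 0) (fun l _ => (hr l).1)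
    (fun l _ => (hr l).2)
  rw [d.hm0] at hl
  have key : ∀ h : ℕ ⊕ ℕ →₀ ℕ, d.Valid h → (∀ l, h (Sum.inr l) = 0) →
      (∀ l, 1 < l → h (Sum.inl l) = 0) →
      h = Finsupp.single (Sum.inl 1) (h (Sum.inl 1)) := by
    intro h hh h1 h2
    classical
    ext (l | l)
    · by_cases hl1 : l = 1
      · simp [hl1]
      · rw [Finsupp.single_apply, if_neg (by simp; omega)]
        by_cases hl0 : l = 0
        · by_contra hn
          exact absurd (hh _ hn).1 (by omega)
        · exact h2 l (by omega)
    · simp [h1]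
  have hkf := key f hf (fun l => (hr l).1) hl.1
  have hkg := key g hg (fun l => (hr l).2) hl.2
  rw [hkf, hkg, weight_single, weight_single] at hw
  have hβ : d.val (Sum.inl 1) ≠ 0 := by
    rw [val_eq adm_one]
    simpa [gen, d.hP1] using d.hνx.ne'
  rw [hkf, hkg, Nat.cast_injective (mul_right_cancel₀ hβ hw)]

/-- Irreducible exponent vectors are determined by their weight. -/
lemma irr_unique {f g : ℕ ⊕ ℕ →₀ ℕ} (hf : d.Valid f) (hg : d.Valid g)
    (hfi : Irr d.TF (toPair f)) (hgi : Irr d.TF (toPair g)) (hw : d.weight f = d.weight g) :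
    f = g := by
  have h1 : (f - g) + g = (g - f) + f := by
    ext j
    simp only [Finsupp.coe_add, Finsupp.coe_tsub, Pi.add_apply, Pi.sub_apply]
    omega
  have h2 := congrArg d.weight h1
  rw [weight_add, weight_add, hw, add_left_inj] at h2
  have h3 := eq_zero_of_disjoint (hf.mono tsub_le_self) (hg.mono tsub_le_self)
    (irr_mono hfi tsub_le_self) (irr_mono hgi tsub_le_self) h2
    (fun j => by simp only [Finsupp.coe_tsub, Pi.sub_apply]; omega)
  rw [h3] at h1
  exact (add_left_cancel h1).symm

end RSetup

end Jump

namespace Jump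

namespace RSetup

variable {K : Type} [Field K] {d : RSetup K}

/-- Modulo monomials of weight greater than `τ`, the monomials of weight at least `τ` span at
most a line over `𝐤`. -/
lemma exists_leading (τ : ℝ) : ∃ M : K, (M = 0 ∨ (M ≠ 0 ∧ d.ν M = τ)) ∧
    ∀ h ∈ d.monGe τ, ∃ c ∈ d.kk, h - c * M ∈ d.monGt τ := by
  obtain ⟨M, hM, hirr⟩ : ∃ M : K, (M = 0 ∨ (M ≠ 0 ∧ d.ν M = τ)) ∧
      ∀ n, d.Valid n → Irr d.TF (toPair n) → d.weight n = τ → d.mon n = M := by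
    by_cases hex : ∃ n, d.Valid n ∧ Irr d.TF (toPair n) ∧ d.weight n = τ
    · obtain ⟨n, hn, hni, hnw⟩ := hex
      exact ⟨d.mon n, Or.inr ⟨mon_ne_zero hn, (nu_mon hn).trans hnw⟩, fun g hg hgi hgw => by
        rw [irr_unique hg hn hgi hni (hgw.trans hnw.symm)]⟩
    · exact ⟨0, Or.inl rfl, fun g hg hgi hgw => absurd ⟨g, hg, hgi, hgw⟩ hex⟩
  refine ⟨M, hM, fun h hh => ?_⟩
  induction hh using Submodule.span_induction with
  | mem a h =>
    obtain ⟨f, ⟨hf, h⟩, rfl⟩ := h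
    rcases h.lt_or_eq with h | h
    · exact ⟨0, d.kk.zero_mem, by simpa using mon_mem_monGt hf h⟩
    · obtain ⟨c, hc, n, hn, hni, hnw, hmem⟩ := exists_irr hf
      rw [hirr n hn hni (hnw.trans h.symm), ← h] at hmem
      exact ⟨c, hc, hmem⟩
  | zero => exact ⟨0, d.kk.zero_mem, by simp⟩
  | add a b _ _ ha hb =>
    obtain ⟨c1, hc1, h1⟩ := ha
    obtain ⟨c2, hc2, h2⟩ := hb
    refine ⟨c1 + c2, d.kk.add_mem hc1 hc2, ?_⟩
    convert add_mem h1 h2 using 1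
    ring
  | smul r a ha ih =>
    obtain ⟨c, hc, h⟩ := ih
    obtain ⟨c0, hc0, u, hu, v, hv, w, hw, hr⟩ := exists_residue r.2
    refine ⟨c0 * c, d.kk.mul_mem hc0 hc, ?_⟩
    obtain ⟨h1, h2, h3⟩ := param_mul_mem_monGt ha
    have h4 := add_mem (smul_mem_of_mem _ (d.hkR hc0) h) (add_mem (add_mem
      (smul_mem_of_mem _ hu h1) (smul_mem_of_mem _ hv h2)) (smul_mem_of_mem _ hw h3))
    convert h4 using 1
    rw [Subring.smul_def, smul_eq_mul, hr]
    ring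

lemma mem_monGt_of_mem_vgt {τ : ℝ} {h : K} (h1 : h ∈ d.monGe τ) (h2 : h ∈ d.vgt τ) :
    h ∈ d.monGt τ := by
  obtain ⟨M, hM, hlead⟩ := exists_leading (d := d) τ
  obtain ⟨c, hc, hmem⟩ := hlead h h1
  have h3 : c * M ∈ d.vgt τ := by
    have := sub_mem h2 (monGt_le_vgt τ hmem)
    simpa using this
  by_cases hcM : c * M = 0
  · simpa [hcM] using hmem
  · have hM0 := right_ne_zero_of_mul hcM
    have h4 := mem_vgt.1 h3 hcM
    rw [nu_smul hc (left_ne_zero_of_mul hcM) hM0, (hM.resolve_left hM0).2] at h4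
    exact absurd h4 (lt_irrefl _)

/-- A sum of nonzero elements of distinct values has the least of these values. -/
lemma sum_of_injOn {ι : Type} {s : Finset ι} (hs : s.Nonempty) {a : ι → K}
    (ha : ∀ i ∈ s, a i ≠ 0) (hinj : ∀ i ∈ s, ∀ j ∈ s, d.ν (a i) = d.ν (a j) → i = j) :
    ∑ i ∈ s, a i ≠ 0 ∧ ∀ i ∈ s, d.ν (∑ i ∈ s, a i) ≤ d.ν (a i) := by
  classical
  obtain ⟨i0, hi0, hmin⟩ := s.exists_min_image (fun i => d.ν (a i)) hs
  have hrest : ∑ i ∈ s.erase i0, a i ∈ d.vgt (d.ν (a i0)) :=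
    sum_mem fun i hi _ => lt_of_le_of_ne (hmin i (Finset.mem_of_mem_erase hi))
      fun h => (Finset.mem_erase.1 hi).1 (hinj i (Finset.mem_of_mem_erase hi) i0 hi0 h.symm)
  have hsum := Finset.add_sum_erase s a hi0
  have hnot : ∑ i ∈ s, a i ∉ d.vgt (d.ν (a i0)) := fun h => by
    have h2 := sub_mem h hrest
    rw [← hsum, add_sub_cancel_right] at h2
    exact lt_irrefl _ (mem_vgt.1 h2 (ha i0 hi0))
  rw [mem_vgt] at hnot
  push Not at hnot
  exact ⟨hnot.1, fun i hi => hnot.2.trans (hmin i hi)⟩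

/-- A finite dimensional `𝐤`-subspace of `K` has finitely many values. -/
lemma finite_values (E : Submodule d.kk K) [FiniteDimensional d.kk E] :
    {t : ℝ | ∃ e ∈ E, e ≠ 0 ∧ d.ν e = t}.Finite := by
  choose e he he0 hev using fun t : {t : ℝ | ∃ e ∈ E, e ≠ 0 ∧ d.ν e = t} => t.2
  have hli : LinearIndependent d.kk (fun t => (⟨e t, he t⟩ : E)) := by
    classical
    rw [linearIndependent_iff']
    intro s c hsum
    by_contra hne
    push Not at hne
    obtain ⟨i, hi, hci⟩ := hne
    have hsum2 : ∑ j ∈ s, (c j : K) * e j = 0 := by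
      have := congrArg (Subtype.val : E → K) hsum
      simpa [Subfield.smul_def] using this
    have hsum3 : ∑ j ∈ s with c j ≠ 0, (c j : K) * e j = 0 := by
      rw [Finset.sum_filter_of_ne, hsum2]
      intro j _ hj hcj
      simp [hcj] at hj
    have hν : ∀ j ∈ s.filter (fun j => c j ≠ 0), d.ν ((c j : K) * e j) = j := fun j hj => by
      rw [nu_smul (c j).2 (by simpa using (Finset.mem_filter.1 hj).2) (he0 j), hev]
    refine (sum_of_injOn (d := d) (s := s.filter (fun j => c j ≠ 0)) ⟨i, by simp [hi, hci]⟩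
      (fun j hj => mul_ne_zero (by simpa using (Finset.mem_filter.1 hj).2) (he0 j))
      (fun j hj l hl h => ?_)).1 hsum3
    rw [hν j hj, hν l hl] at h
    exact Subtype.ext h
  exact Set.finite_coe_iff.1 (LinearIndependent.finite hli)

lemma exists_finiteDimensional (n : ℕ) : ∃ E : Submodule d.kk K, FiniteDimensional d.kk E ∧
    ∀ f ∈ d.R, ∃ e ∈ E, f - e ∈ d.vge (n * d.ν d.x) := by
  induction n with
  | zero =>
    refine ⟨⊥, inferInstance, fun f hf => ⟨0, zero_mem _, fun h => ?_⟩⟩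
    rw [sub_zero] at h ⊢
    simpa using d.hdom f hf h
  | succ n ih =>
    obtain ⟨E, hE, hEf⟩ := ih
    have key : ∀ w, w ≠ 0 → d.ν d.x ≤ d.ν w → ∀ a ∈ d.R,
        ∃ e ∈ E, w * a - w * e ∈ d.vge ((n + 1 : ℕ) * d.ν d.x) := by
      intro w hw0 hw a ha
      obtain ⟨e, he, h⟩ := hEf a ha
      refine ⟨e, he, fun hne => ?_⟩
      rw [← mul_sub] at hne ⊢
      have h2 := mem_vge.1 h (right_ne_zero_of_mul hne)
      rw [d.hmul _ _ hw0 (right_ne_zero_of_mul hne)]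
      push_cast
      linarith
    refine ⟨Submodule.span d.kk {1} ⊔ (E.map (LinearMap.mulLeft d.kk d.x) ⊔
      (E.map (LinearMap.mulLeft d.kk d.y) ⊔ E.map (LinearMap.mulLeft d.kk d.z))),
      inferInstance, fun f hf => ?_⟩
    obtain ⟨c, hc, a, ha, b, hb, e, he, rfl⟩ := exists_residue hf
    obtain ⟨a1, ha1, h1⟩ := key d.x d.hxne le_rfl a ha
    obtain ⟨b1, hb1, h2⟩ := key d.y d.hyne d.hνxy b hb
    obtain ⟨e1, he1, h3⟩ := key d.z d.hzne (d.hνxy.trans d.hνyz) e he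
    refine ⟨c + (d.x * a1 + (d.y * b1 + d.z * e1)), ?_, ?_⟩
    · refine Submodule.add_mem_sup (Submodule.mem_span_singleton.2 ⟨⟨c, hc⟩, ?_⟩)
        (Submodule.add_mem_sup ⟨a1, ha1, rfl⟩
          (Submodule.add_mem_sup ⟨b1, hb1, rfl⟩ ⟨e1, he1, rfl⟩))
      simp [Subfield.smul_def]
    · convert add_mem (add_mem h1 h2) h3 using 1
      ring

/-- There are finitely many values of elements of `R` below any bound. -/
lemma finite_values_lt (σ : ℝ) : {t : ℝ | t < σ ∧ ∃ f ∈ d.R, f ≠ 0 ∧ d.ν f = t}.Finite := by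
  obtain ⟨n, hn⟩ := exists_nat_ge (σ / d.ν d.x)
  rw [div_le_iff₀ d.hνx] at hn
  obtain ⟨E, hE, hEf⟩ := exists_finiteDimensional (d := d) n
  refine (finite_values E).subset ?_
  rintro t ⟨ht, f, hf, hf0, rfl⟩
  obtain ⟨e, he, hfe⟩ := hEf f hf
  have h1 : f ∉ d.vgt (d.ν f) := fun h => lt_irrefl _ (h hf0)
  have h2 : f - e ∈ d.vgt (d.ν f) := fun h => ht.trans_le (hn.trans (hfe h))
  have h3 : e ∉ d.vgt (d.ν f) := fun h => h1 (by simpa using add_mem h2 h)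
  have h4 : e ∈ d.vge (d.ν f) := by
    have h5 : f - e ∈ d.vge (d.ν f) := fun h => (h2 h).le
    have h6 : f ∈ d.vge (d.ν f) := fun _ => le_rfl
    simpa using sub_mem h6 h5
  rw [mem_vgt] at h3
  push Not at h3
  exact ⟨e, he, h3.1, le_antisymm h3.2 (h4 h3.1)⟩

/-- The jumping polynomials form a generating sequence. -/
lemma mem_monGe {σ : ℝ} {f : K} (hf : f ∈ d.R) (hσ : f ∈ d.vge σ) : f ∈ d.monGe σ := by
  have hone : f ∈ d.monGe 0 := by
    have := smul_mem_of_mem _ hf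
      (mon_mem_monGe (d := d) valid_zero (τ := 0) (by rw [weight_zero]))
    simpa using this
  have hanti : ∀ {a b : ℝ}, a ≤ b → d.monGe b ≤ d.monGe a := fun h =>
    Submodule.span_mono (Set.image_mono fun _ h2 => ⟨h2.1, h.trans h2.2⟩)
  by_cases h0 : 0 < σ
  swap
  · exact hanti (not_lt.1 h0) hone
  have hfin := finite_values_lt (d := d) σ
  obtain ⟨w, ⟨⟨hw, hwR⟩, hfw⟩, hmax⟩ := Set.exists_max_image
    ({t : ℝ | t < σ ∧ ∃ f ∈ d.R, f ≠ 0 ∧ d.ν f = t} ∩ {t | f ∈ d.monGe t}) id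
    (hfin.subset Set.inter_subset_left)
    ⟨0, ⟨h0, 1, d.R.one_mem, one_ne_zero, nu_one⟩, hone⟩
  have hgt := mem_monGt_of_mem_vgt hfw fun h => hw.trans_le (hσ h)
  by_cases hex : ∃ t, t < σ ∧ w < t ∧ ∃ f ∈ d.R, f ≠ 0 ∧ d.ν f = t
  · obtain ⟨t, ⟨⟨ht, htR⟩, hwt⟩, hmin⟩ := Set.exists_min_image
      ({t : ℝ | t < σ ∧ ∃ f ∈ d.R, f ≠ 0 ∧ d.ν f = t} ∩ {t | w < t}) id
      (hfin.subset Set.inter_subset_left)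
      (by obtain ⟨t, h1, h2, h3⟩ := hex; exact ⟨t, ⟨h1, h3⟩, h2⟩)
    have hle : d.monGt w ≤ d.monGe t := by
      refine Submodule.span_mono (Set.image_mono fun g hg => ⟨hg.1, ?_⟩)
      by_contra h
      rw [not_le] at h
      exact absurd (hmin _ ⟨⟨h.trans ht, d.mon g, mon_mem hg.1, mon_ne_zero hg.1, nu_mon hg.1⟩,
        hg.2⟩) (not_le.2 h)
    exact absurd (hmax t ⟨⟨ht, htR⟩, hle hgt⟩) (not_le.2 hwt)
  · have hle : d.monGt w ≤ d.monGe σ := by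
      refine Submodule.span_mono (Set.image_mono fun g hg => ⟨hg.1, ?_⟩)
      by_contra h
      rw [not_le] at h
      exact hex ⟨_, h, hg.2, d.mon g, mon_mem hg.1, mon_ne_zero hg.1, nu_mon hg.1⟩
    exact hle hgt

/-- The `R`-module generated by the monomials of weight at least `τ` with all exponents outside
`I` equal to zero. -/
noncomputable def monOn (d : RSetup K) (I : Set (ℕ ⊕ ℕ)) (τ : ℝ) : Submodule d.R K :=
  Submodule.span d.R (d.mon '' {f | d.Valid f ∧ (∀ i, i ∉ I → f i = 0) ∧ τ ≤ d.weight f})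

lemma monOn_anti (I : Set (ℕ ⊕ ℕ)) {a b : ℝ} (h : a ≤ b) : d.monOn I b ≤ d.monOn I a :=
  Submodule.span_mono (Set.image_mono fun _ h2 => ⟨h2.1, h2.2.1, h.trans h2.2.2⟩)

lemma mon_mem_monOn {I : Set (ℕ ⊕ ℕ)} {f : ℕ ⊕ ℕ →₀ ℕ} (hf : d.Valid f)
    (h : ∀ i, i ∉ I → f i = 0) : d.mon f ∈ d.monOn I (d.weight f) :=
  Submodule.subset_span ⟨f, ⟨hf, h, le_rfl⟩, rfl⟩

lemma mul_mem_monOn {I : Set (ℕ ⊕ ℕ)} {τ τ2 : ℝ} {a b : K} (ha : a ∈ d.monOn I τ)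
    (hb : b ∈ d.monOn I τ2) : a * b ∈ d.monOn I (τ + τ2) := by
  induction ha using Submodule.span_induction with
  | mem a h =>
    obtain ⟨f, ⟨hf, hfI, h⟩, rfl⟩ := h
    induction hb using Submodule.span_induction with
    | mem b h2 =>
      obtain ⟨g, ⟨hg, hgI, h2⟩, rfl⟩ := h2
      rw [← mon_add]
      exact Submodule.subset_span ⟨f + g, ⟨hf.add hg,
        fun i hi => by simp [hfI i hi, hgI i hi], by rw [weight_add]; linarith⟩, rfl⟩
    | zero => simp
    | add a b _ _ ha hb => rw [mul_add]; exact add_mem ha hb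
    | smul r a _ ha => rw [mul_smul_comm]; exact Submodule.smul_mem _ _ ha
  | zero => simp
  | add a b _ _ ha hb => rw [add_mul]; exact add_mem ha hb
  | smul r a _ ha => rw [smul_mul_assoc]; exact Submodule.smul_mem _ _ ha

/-- If each jumping polynomial is a combination of monomials in the jumping polynomials with
index in `I` of no smaller weight, then so is each monomial. -/
lemma monGe_le_monOn {I : Set (ℕ ⊕ ℕ)} (hI : ∀ i, d.Adm i → d.gen i ∈ d.monOn I (d.val i))
    (σ : ℝ) : d.monGe σ ≤ d.monOn I σ := by
  have hone : (1 : K) ∈ d.monOn I 0 := by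
    simpa using mon_mem_monOn (d := d) (I := I) valid_zero (fun _ _ => rfl)
  have hpow : ∀ i, d.Adm i → ∀ n : ℕ, d.gen i ^ n ∈ d.monOn I (n * d.val i) := by
    intro i hi n
    induction n with
    | zero => simpa using hone
    | succ n ih =>
      rw [pow_succ]
      convert mul_mem_monOn ih (hI i hi) using 1
      push_cast
      ring_nf
  refine Submodule.span_le.2 ?_
  rintro _ ⟨f, ⟨hf, h⟩, rfl⟩
  refine monOn_anti I h ?_
  clear h
  induction f using Finsupp.induction with
  | zero => simpa using hone
  | single_add i n f _ hn ih =>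
    rw [mon_add, weight_add, mon_single, weight_single]
    classical
    refine mul_mem_monOn (hpow i (hf i ?_) n) (ih (hf.mono le_add_self))
    simp [hn]

/-- A combination of distinct irreducible monomials not involving the indices outside `I`. -/
lemma mem_monOn_of_eq_sum {I : Set (ℕ ⊕ ℕ)} (hI : ∀ f : ℕ ⊕ ℕ →₀ ℕ, d.Valid f →
      Irr d.TF (toPair f) → ∀ i, i ∉ I → f i = 0) {i : ℕ ⊕ ℕ} (hi : d.Adm i) {M : ℕ}
    {χ : Fin M → K} {kb ib : Fin M → ℕ} {X Y : Fin M → Vec}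
    (hχ : ∀ e, χ e ∈ d.kk ∧ χ e ≠ 0) (hkb : ∀ e, ((kb e : ℕ) : ℕ∞) ≤ d.len)
    (hX : ∀ e, Supp (kb e) (X e)) (hY : ∀ e, Supp (ib e) (Y e))
    (hinj : ∀ e e', X e = X e' → Y e = Y e' → e = e') (hirr : ∀ e, Irr d.TF (X e, Y e))
    (hsum : d.gen i = ∑ e, χ e * (d.Pm (kb e) (X e) * d.Tm (ib e) (Y e))) :
    d.gen i ∈ d.monOn I (d.val i) := by
  choose f hf using fun e => exists_toPair (hX e) (hY e)
  have hfi : ∀ e, Irr d.TF (toPair (f e)) := fun e => by rw [hf e]; exact hirr e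
  have hfv : ∀ e, d.Valid (f e) := by
    rintro e (l | l) hl
    · have h1 : X e l ≠ 0 := by
        rwa [← show f e (Sum.inl l) = X e l from congrFun (congrArg Prod.fst (hf e)) l]
      have h2 := mt (hX e l) h1
      refine ⟨by omega, le_trans ?_ (hkb e)⟩
      exact_mod_cast (by omega : l ≤ kb e)
    · have h1 : Y e l ≠ 0 := by
        rwa [← show f e (Sum.inr l) = Y e l from congrFun (congrArg Prod.snd (hf e)) l]
      have h2 := mt (hY e l) h1
      refine ⟨by omega, fun hT => hirr e _ (TC_subset_TF _ (unit_mem_TC (by omega) hT))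
        ⟨fun _ => Nat.zero_le _, fun l2 => ?_⟩⟩
      by_cases h : l2 = l
      · subst h; simp only [unitVec, if_true]; omega
      · simp [unitVec, h]
  have hsum2 : d.gen i = ∑ e, χ e * d.mon (f e) := by
    rw [hsum]
    exact Finset.sum_congr rfl fun e _ => by rw [mon_eq d (hX e) (hY e) (hf e)]
  have hν : ∀ e, d.ν (χ e * d.mon (f e)) = d.weight (f e) := fun e => by
    rw [nu_smul (hχ e).1 (hχ e).2 (mon_ne_zero (hfv e)), nu_mon (hfv e)]
  have hle : ∀ e, d.val i ≤ d.weight (f e) := by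
    intro e
    have := (sum_of_injOn (d := d) (s := Finset.univ) ⟨e, Finset.mem_univ e⟩
      (a := fun e => χ e * d.mon (f e))
      (fun e _ => mul_ne_zero (hχ e).2 (mon_ne_zero (hfv e))) (fun e1 _ e2 _ h => by
        rw [hν, hν] at h
        have h2 := irr_unique (hfv e1) (hfv e2) (hfi e1) (hfi e2) h
        have h3 : (X e1, Y e1) = (X e2, Y e2) := by rw [← hf, ← hf, h2]
        exact hinj _ _ (congrArg Prod.fst h3) (congrArg Prod.snd h3))).2 e (Finset.mem_univ e)
    rwa [← hsum2, ← val_eq hi, hν] at this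
  rw [hsum2]
  exact sum_mem fun e _ => smul_mem_of_mem _ (d.hkR (hχ e).1)
    (monOn_anti I (hle e) (mon_mem_monOn (hfv e) (hI _ (hfv e) (hfi e))))

lemma mem_grpOne_of_mem_Sg {β : ℕ → ℝ} {n : ℕ} {x : ℝ} (h : x ∈ Sg β n) : x ∈ grpOne β n := by
  obtain ⟨A, -, rfl⟩ := h
  refine sum_mem fun l hl => ?_
  rw [Finset.mem_Icc] at hl
  rw [← nsmul_eq_mul]
  exact nsmul_mem (mem_grpOne _ hl.1 hl.2) _

/-- If `β_j` lies in the semigroup of the previous values, `P_j` divides no irreducible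
monomial. -/
lemma irr_apply_inl_eq_zero {j : ℕ} (hj : 1 ≤ j ∧ (j : ℕ∞) ≤ d.len)
    (hS : d.β j ∈ Sg d.β (j - 1)) {f : ℕ ⊕ ℕ →₀ ℕ} (hirr : Irr d.TF (toPair f)) :
    f (Sum.inl j) = 0 := by
  by_contra hne
  have hj2 : 2 ≤ j := by
    by_contra h
    obtain rfl : j = 1 := by omega
    have h1 : d.β 1 = d.ν d.x := by rw [d.hβ 1 le_rfl hj.2, d.hP1]
    obtain ⟨A, -, hw⟩ := hS
    have := d.hνx
    rw [← h1, hw] at this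
    simp [wtA] at this
  have h1 := mem_grpOne_of_mem_Sg hS
  have h2 := (sInf_spec (d.hq j hj2 hj.2)).2 1 one_pos (mem_Gr.2 (by simpa using h1))
  cases hq : d.q j with
  | top =>
    rw [hq] at h2
    exact absurd (top_le_iff.1 h2) (ENat.natCast_ne_top _)
  | coe t =>
    rw [hq, Nat.cast_le] at h2
    refine hirr _ (Pset_subset_TF ⟨j, hj2, t, hq, rfl⟩) ⟨fun l => ?_, fun _ => Nat.zero_le _⟩
    by_cases h : l = j
    · subst h
      simp only [unitVec, if_true, toPair]
      omega
    · simp [unitVec, h]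

/-- If `γ_j` lies in the semigroup of the previous values, `T_j` divides no irreducible
monomial. -/
lemma irr_apply_inr_eq_zero {j : ℕ} (hj : 1 ≤ j)
    (hS : d.γ j ∈ SU d.β d.γ (d.m j) (j - 1)) {f : ℕ ⊕ ℕ →₀ ℕ} (hf : d.Valid f)
    (hirr : Irr d.TF (toPair f)) : f (Sum.inr j) = 0 := by
  classical
  by_contra hne
  have hT := (hf _ hne).2
  have hle : Finsupp.single (Sum.inr j) 1 ≤ f :=
    Finsupp.single_le_iff.2 (Nat.pos_of_ne_zero hne)
  have hv := valid_single (hf _ hne) 1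
  obtain ⟨h1, h2⟩ := supp_of_valid hv (k := d.m j) (i := j)
    (fun l _ => by simp)
    (fun l hl => by rw [Finsupp.single_apply, if_neg (by simp; omega)])
  refine not_irr_of_push hj hT (fun hs => ?_) h1 h2 ⟨by simp [toPair], ?_⟩ (irr_mono hirr hle)
  · obtain ⟨a, ha, b, hb, hab⟩ := hS
    have h3 : d.γ j ∈ grpOne d.β (d.m j) ⊔ grpOne d.γ (j - 1) := by
      rw [hab]
      exact AddSubgroup.add_mem_sup (mem_grpOne_of_mem_Sg ha) (mem_grpOne_of_mem_Sg hb)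
    have h4 := (sInf_spec (d.hs j hj hT)).2 1 one_pos
      (mem_GH (d.hmlen j).2 (by simpa using h3))
    rw [hs] at h4
    exact absurd (top_le_iff.1 h4) (ENat.natCast_ne_top _)
  · rw [← weight_eq d h1 h2 rfl]
    simpa [val] using hS

end RSetup

end Jump

namespace Jump

namespace RSetup

variable {K : Type} [Field K] {d : RSetup K}

lemma exists_supp {f : ℕ ⊕ ℕ →₀ ℕ} (hf : d.Valid f) :
    ∃ k i : ℕ, (k : ℕ∞) ≤ d.len ∧ Supp k (toPair f).1 ∧ Supp i (toPair f).2 := by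
  obtain ⟨N, hN1, hN2⟩ := exists_bound f
  by_cases hne : ∃ l, f (Sum.inl l) ≠ 0
  · obtain ⟨k, hk, hk2⟩ := exists_last (N := N) (fun l hl => not_not.2 (hN1 l hl)) hne
    exact ⟨k, N, (hf _ hk).2, supp_of_valid hf (fun l hl => not_not.1 (hk2 l hl)) hN2⟩
  · push Not at hne
    exact ⟨0, N, by simp, supp_of_valid hf (fun l _ => hne l) hN2⟩

lemma monomial_mem {k i : ℕ} {A C : Vec} (hk : (k : ℕ∞) ≤ d.len) (hA : Supp k A)
    (hC : Supp i C) : d.Pm k A * d.Tm i C ∈ d.R ∧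
      d.Pm k A * d.Tm i C ∈ d.vge (wt d.β d.γ k i (A, C)) := by
  obtain ⟨f, hf⟩ := exists_toPair hA hC
  rw [← mon_eq d hA hC hf, ← weight_eq d hA hC hf]
  by_cases hv : d.Valid f
  · exact ⟨mon_mem hv, fun _ => (nu_mon hv).ge⟩
  · suffices d.mon f = 0 by rw [this]; exact ⟨zero_mem _, zero_mem _⟩
    rw [Valid] at hv
    push Not at hv
    obtain ⟨l | l, hl, hadm⟩ := hv
    · have h1 : A l ≠ 0 := by
        rwa [← show f (Sum.inl l) = A l from congrFun (congrArg Prod.fst hf) l]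
      have h2 := mt (hA l) h1
      refine absurd ⟨by omega, le_trans ?_ hk⟩ hadm
      exact_mod_cast (by omega : l ≤ k)
    · have h1 : C l ≠ 0 := by
        rwa [← show f (Sum.inr l) = C l from congrFun (congrArg Prod.snd hf) l]
      have h2 := mt (hC l) h1
      have hT : d.T l = 0 := by
        by_contra hT
        exact hadm ⟨by omega, hT⟩
      refine Finset.prod_eq_zero (Finsupp.mem_support_iff.2 hl) ?_
      change d.T l ^ f (Sum.inr l) = 0
      rw [hT, zero_pow hl]

end RSetup

end Jump

namespace Jump

/-- Lemma 5.4: redundant jumping polynomials. Let `J, J′ ⊆ ℕ`. Suppose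
that for every `i ∈ J`, `β_i ∈ S_{i−1}` and `P_i` is a finite linear combination, with
nonzero coefficients in `𝐤`, of distinct monomials `P^{X_e}T^{Y_e}` with `(X_e, Y_e)`
irreducible with respect to `𝒯`; and that for every `j ∈ J′`, `γ_j ∈ S_{m_j} + U_{j−1}`
and `T_j` is a finite (possibly trivial) such linear combination. Then
`{P_i}_{i∉J} ∪ {T_j}_{j∉J′}` is a generating sequence of `ν` in `R`: for every
`σ ∈ S_R = ν(R∖{0})`, the ideal `I_σ` equals the ideal of `R` generated by the monomials
`P^AT^C` with `|(A, C)| ≥ σ` and `a_i = 0` for `i ∈ J`, `c_j = 0` for `j ∈ J′`. -/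
theorem redundant_generators {K : Type} [Field K] (d : RSetup K) (J J' : Set ℕ)
    (hJmem : ∀ i ∈ J, 1 ≤ i ∧ (i : ℕ∞) ≤ d.len)
    (hJ'mem : ∀ j ∈ J', 1 ≤ j)
    (hJ : ∀ i ∈ J, d.β i ∈ Sg d.β (i - 1) ∧
      ∃ (M : ℕ) (χ : Fin M → K) (kb ib : Fin M → ℕ) (X Y : Fin M → Vec),
        1 ≤ M ∧ (∀ e, χ e ∈ d.kk ∧ χ e ≠ 0) ∧
        (∀ e, ((kb e : ℕ) : ℕ∞) ≤ d.len) ∧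
        (∀ e, Supp (kb e) (X e)) ∧ (∀ e, Supp (ib e) (Y e)) ∧
        (∀ e e', X e = X e' → Y e = Y e' → e = e') ∧
        (∀ e, Irr d.TF (X e, Y e)) ∧
        d.P i = ∑ e, χ e * (d.Pm (kb e) (X e) * d.Tm (ib e) (Y e)))
    (hJ' : ∀ j ∈ J', d.γ j ∈ SU d.β d.γ (d.m j) (j - 1) ∧
      ∃ (N : ℕ) (ψ : Fin N → K) (kb ib : Fin N → ℕ) (Z W : Fin N → Vec),
        (∀ e, ψ e ∈ d.kk ∧ ψ e ≠ 0) ∧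
        (∀ e, ((kb e : ℕ) : ℕ∞) ≤ d.len) ∧
        (∀ e, Supp (kb e) (Z e)) ∧ (∀ e, Supp (ib e) (W e)) ∧
        (∀ e e', Z e = Z e' → W e = W e' → e = e') ∧
        (∀ e, Irr d.TF (Z e, W e)) ∧
        d.T j = ∑ e, ψ e * (d.Pm (kb e) (Z e) * d.Tm (ib e) (W e))) :
    ∀ σ ∈ d.SR, d.Iv σ =
      {f : K | ∃ (M : ℕ) (g : Fin M → K) (kb ib : Fin M → ℕ) (A C : Fin M → Vec),
        (∀ e, g e ∈ d.R) ∧ (∀ e, ((kb e : ℕ) : ℕ∞) ≤ d.len) ∧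
        (∀ e, Supp (kb e) (A e)) ∧ (∀ e, Supp (ib e) (C e)) ∧
        (∀ e l, l ∈ J → A e l = 0) ∧ (∀ e l, l ∈ J' → C e l = 0) ∧
        (∀ e, σ ≤ wt d.β d.γ (kb e) (ib e) (A e, C e)) ∧
        f = ∑ e, g e * (d.Pm (kb e) (A e) * d.Tm (ib e) (C e))} := by
  intro σ _
  let I : Set (ℕ ⊕ ℕ) := {i | Sum.elim (fun l => l ∉ J) (fun l => l ∉ J') i}
  have hI1 : ∀ f : ℕ ⊕ ℕ →₀ ℕ, d.Valid f → Irr d.TF (RSetup.toPair f) →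
      ∀ i, i ∉ I → f i = 0 := by
    rintro f hf hirr (l | l) hl
    · have hl : l ∈ J := not_not.1 hl
      exact RSetup.irr_apply_inl_eq_zero (hJmem l hl) (hJ l hl).1 hirr
    · have hl : l ∈ J' := not_not.1 hl
      exact RSetup.irr_apply_inr_eq_zero (hJ'mem l hl) (hJ' l hl).1 hf hirr
  have hI2 : ∀ i, d.Adm i → d.gen i ∈ d.monOn I (d.val i) := by
    intro i hi
    by_cases hiI : i ∈ I
    · classical
      have h := RSetup.mon_mem_monOn (d := d) (I := I) (RSetup.valid_single hi 1) fun l hl => by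
        rw [Finsupp.single_apply, if_neg]
        rintro rfl
        exact hl hiI
      rw [RSetup.mon_single, RSetup.weight_single] at h
      simpa using h
    · obtain l | l := i
      · obtain ⟨-, M, χ, kb, ib, X, Y, -, hχ, hkb, hX, hY, hinj, hirr, hsum⟩ := hJ l (not_not.1 hiI)
        exact RSetup.mem_monOn_of_eq_sum hI1 hi hχ hkb hX hY hinj hirr hsum
      · obtain ⟨-, M, χ, kb, ib, X, Y, hχ, hkb, hX, hY, hinj, hirr, hsum⟩ := hJ' l (not_not.1 hiI)
        exact RSetup.mem_monOn_of_eq_sum hI1 hi hχ hkb hX hY hinj hirr hsum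
  ext f
  constructor
  · intro hf
    have h := RSetup.monGe_le_monOn hI2 σ
      (RSetup.mem_monGe hf.1 fun h0 => hf.2.resolve_left h0)
    obtain ⟨n, c, g, hg⟩ := Submodule.mem_span_set'.1 h
    choose F hF hFg using fun e => (g e).2
    choose kb ib hkb hA hC using fun e => RSetup.exists_supp (hF e).1
    refine ⟨n, fun e => c e, kb, ib, fun e => (RSetup.toPair (F e)).1,
      fun e => (RSetup.toPair (F e)).2, fun e => (c e).2, hkb, hA, hC,
      fun e l hl => (hF e).2.1 (Sum.inl l) (not_not.2 hl),
      fun e l hl => (hF e).2.1 (Sum.inr l) (not_not.2 hl), fun e => ?_, ?_⟩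
    · rw [← RSetup.weight_eq d (hA e) (hC e) rfl]
      exact (hF e).2.2
    · rw [← hg]
      refine Finset.sum_congr rfl fun e _ => ?_
      rw [← RSetup.mon_eq d (hA e) (hC e) rfl, hFg, Subring.smul_def, smul_eq_mul]
  · rintro ⟨M, g, kb, ib, A, C, hg, hkb, hA, hC, -, -, hσ, rfl⟩
    have hmem := fun e => RSetup.monomial_mem (hkb e) (hA e) (hC e)
    have hge : ∑ e, g e * (d.Pm (kb e) (A e) * d.Tm (ib e) (C e)) ∈ d.vge σ :=
      sum_mem fun e _ => RSetup.smul_mem_of_mem _ (hg e)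
        fun h0 => (hσ e).trans ((hmem e).2 h0)
    exact ⟨sum_mem fun e _ => mul_mem (hg e) (hmem e).1, or_iff_not_imp_left.2 hge⟩

end Jump
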